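/- Let ℓ ≤ 4. Whether an arrangement A in K^ℓ has a free filtration depends only on its intersection lattice L(A): if A and B are arrangements in K^ℓ whose intersection lattices are isomorphic, then A has a free filtration if and only if B has a free filtration. -/

import Mathlib

open MvPolynomial

noncomputable section

attribute [local instance] Classical.propDecidable

namespace ArrPOG

variable (K : Type) [Field K] (ℓ : ℕ)

/-- A polynomial vector field on `K^ℓ`: `θ = Σ θᵢ ∂/∂xᵢ`, identified with its
coefficient vector `(θ₁,…,θ_ℓ)` in `S = K[x₁,…,x_ℓ]`. -/
abbrev Deriv : Type := Fin ℓ → MvPolynomial (Fin ℓ) K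

variable {K ℓ}

/-- The linear polynomial `α_H ∈ S` associated to a linear form `φ ∈ V*`. -/
def linPoly (φ : Module.Dual K (Fin ℓ → K)) : MvPolynomial (Fin ℓ) K :=
  ∑ i, MvPolynomial.C (φ (Pi.single i 1)) * MvPolynomial.X i

/-- `θ(α)` for a derivation `θ` and the linear form `α` given by `φ ∈ V*`. -/
def applyLin (θ : Deriv K ℓ) (φ : Module.Dual K (Fin ℓ → K)) : MvPolynomial (Fin ℓ) K :=
  ∑ i, MvPolynomial.C (φ (Pi.single i 1)) * θ i

/-- An arrangement: a finite set of hyperplanes (kernels of nonzero linear forms). -/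
def IsArrangement (A : Finset (Submodule K (Fin ℓ → K))) : Prop :=
  ∀ H ∈ A, ∃ φ : Module.Dual K (Fin ℓ → K), φ ≠ 0 ∧ LinearMap.ker φ = H

/-- Essential: the common intersection of all members is `0`. -/
def Essential (A : Finset (Submodule K (Fin ℓ → K))) : Prop :=
  A.inf id = ⊥

/-- Membership in the logarithmic derivation module `D(A)`:
`θ(α_H) ∈ S·α_H` for every `H ∈ A`. -/
def InD (A : Finset (Submodule K (Fin ℓ → K))) (θ : Deriv K ℓ) : Prop :=
  ∀ H ∈ A, ∀ φ : Module.Dual K (Fin ℓ → K), LinearMap.ker φ = H → linPoly φ ∣ applyLin θ φ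

/-- A derivation is homogeneous of degree `n` if all its coefficients are. -/
def HomogDeriv (θ : Deriv K ℓ) (n : ℕ) : Prop := ∀ i, (θ i).IsHomogeneous n

/-- `θ₁,…,θₙ` generate `D(A)` as an `S`-module. -/
def GeneratesD {n : ℕ} (A : Finset (Submodule K (Fin ℓ → K))) (θ : Fin n → Deriv K ℓ) : Prop :=
  (∀ i, InD A (θ i)) ∧
    ∀ η, InD A η → ∃ c : Fin n → MvPolynomial (Fin ℓ) K, η = ∑ i, c i • θ i

/-- `S`-linear independence of a family of derivations. -/
def IndepD {n : ℕ} (θ : Fin n → Deriv K ℓ) : Prop :=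
  ∀ c : Fin n → MvPolynomial (Fin ℓ) K, (∑ i, c i • θ i) = 0 → ∀ i, c i = 0

/-- `A` is free with exponents `e`: `D(A)` has a homogeneous basis of degrees `e i`. -/
def IsFreeExp (A : Finset (Submodule K (Fin ℓ → K))) (e : Fin ℓ → ℕ) : Prop :=
  ∃ θ : Fin ℓ → Deriv K ℓ, (∀ i, HomogDeriv (θ i) (e i)) ∧ GeneratesD A θ ∧ IndepD θ

/-- `A` is free. -/
def IsFree (A : Finset (Submodule K (Fin ℓ → K))) : Prop := ∃ e, IsFreeExp A e

/-- `A` is plus-one generated with exponents `e`, level `lev`, realized by the minimal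
homogeneous generators `θ₁,…,θ_ℓ, φ` whose unique syzygy is `Σ fᵢ•θᵢ + α•φ = 0`:
this encodes the minimal free resolution
`0 → S[-lev-1] → S[-lev] ⊕ (⊕ S[-eᵢ]) → D(A) → 0`. -/
def IsPOGWith (A : Finset (Submodule K (Fin ℓ → K))) (e : Fin ℓ → ℕ) (lev : ℕ)
    (θ : Fin ℓ → Deriv K ℓ) (φ : Deriv K ℓ)
    (f : Fin ℓ → MvPolynomial (Fin ℓ) K) (α : MvPolynomial (Fin ℓ) K) : Prop :=
  (∀ i, InD A (θ i)) ∧ InD A φ ∧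
  (∀ i, HomogDeriv (θ i) (e i)) ∧ HomogDeriv φ lev ∧
  (∀ η, InD A η → ∃ (c : Fin ℓ → MvPolynomial (Fin ℓ) K) (g : MvPolynomial (Fin ℓ) K),
      η = (∑ i, c i • θ i) + g • φ) ∧
  α.IsHomogeneous 1 ∧
  (∀ i, (f i).IsHomogeneous (lev + 1 - e i)) ∧
  (∀ i, MvPolynomial.constantCoeff (f i) = 0) ∧
  ((∑ i, f i • θ i) + α • φ = 0) ∧
  (¬ (α = 0 ∧ ∀ i, f i = 0)) ∧
  (∀ (g : Fin ℓ → MvPolynomial (Fin ℓ) K) (h : MvPolynomial (Fin ℓ) K),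
      ((∑ i, g i • θ i) + h • φ = 0) →
      ∃ q : MvPolynomial (Fin ℓ) K, (∀ i, g i = q * f i) ∧ h = q * α)

/-- Plus-one generated with exponents `e` and level `lev`. -/
def IsPOG (A : Finset (Submodule K (Fin ℓ → K))) (e : Fin ℓ → ℕ) (lev : ℕ) : Prop :=
  ∃ θ φ f α, IsPOGWith A e lev θ φ f α

/-- Strictly plus-one generated: the level coefficient `α` is nonzero. -/
def IsSPOG (A : Finset (Submodule K (Fin ℓ → K))) (e : Fin ℓ → ℕ) (lev : ℕ) : Prop :=
  ∃ θ φ f α, IsPOGWith A e lev θ φ f α ∧ α ≠ 0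

/-- The restriction `A^H = {L ⊓ H | L ∈ A \ {H}}`. -/
def restrict (A : Finset (Submodule K (Fin ℓ → K))) (H : Submodule K (Fin ℓ → K)) :
    Finset (Submodule K (Fin ℓ → K)) :=
  (A.erase H).image (fun L => L ⊓ H)

/-- The localization `A_X = {L ∈ A | X ⊆ L}`. -/
def localize (A : Finset (Submodule K (Fin ℓ → K))) (X : Submodule K (Fin ℓ → K)) :
    Finset (Submodule K (Fin ℓ → K)) :=
  A.filter (fun L => X ≤ L)

/-- The intersection lattice of `A`, inside the ambient space `T`. -/
def latticeOf (T : Submodule K (Fin ℓ → K)) (A : Finset (Submodule K (Fin ℓ → K))) :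
    Finset (Submodule K (Fin ℓ → K)) :=
  A.powerset.image (fun B => T ⊓ B.inf id)

/-- The Möbius function of the poset `L` (intersection lattice with top `T`). -/
def mob (T : Submodule K (Fin ℓ → K)) (L : Finset (Submodule K (Fin ℓ → K)))
    (X : Submodule K (Fin ℓ → K)) : ℤ :=
  if X = T then 1
  else - ∑ Y ∈ (L.filter fun Z => X < Z).attach, mob T L Y.1
termination_by (L.filter fun Z => X < Z).card
decreasing_by
  obtain ⟨Y, hY⟩ := Y
  simp only [Finset.mem_filter] at hY
  apply Finset.card_lt_card
  rw [Finset.ssubset_def]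
  constructor
  · intro Z hZ
    simp only [Finset.mem_filter] at hZ ⊢
    exact ⟨hZ.1, lt_trans hY.2 hZ.2⟩
  · intro hsub
    have h2 := hsub (Finset.mem_filter.mpr ⟨hY.1, hY.2⟩)
    simp only [Finset.mem_filter] at h2
    exact lt_irrefl Y h2.2

/-- The characteristic polynomial `χ(A;t) = Σ_{X ∈ L(A)} μ(X) t^{dim X}`
of an arrangement inside the ambient space `T`. -/
def charPoly (T : Submodule K (Fin ℓ → K)) (A : Finset (Submodule K (Fin ℓ → K))) :
    Polynomial ℤ :=
  ∑ X ∈ latticeOf T A,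
    Polynomial.C (mob T (latticeOf T A) X) * Polynomial.X ^ (Module.finrank K X)

/-- The Betti number `b_i(A)`: `χ(A;t) = Σ (-1)^i b_i(A) t^{ℓ-i}`. -/
def bNum (A : Finset (Submodule K (Fin ℓ → K))) (i : ℕ) : ℤ :=
  (-1) ^ i * (charPoly (⊤ : Submodule K (Fin ℓ → K)) A).coeff (ℓ - i)

/-- Evaluation of the Poincaré polynomial `π(A;t) = Σ μ(X) (-t)^{codim X}` at `t : ℚ`. -/
def poincareEval (A : Finset (Submodule K (Fin ℓ → K))) (t : ℚ) : ℚ :=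
  ∑ X ∈ latticeOf ⊤ A,
    (mob (⊤ : Submodule K (Fin ℓ → K)) (latticeOf ⊤ A) X : ℚ) *
      (-t) ^ (ℓ - Module.finrank K X)

/-- The Euler derivation `θ_E = Σ xᵢ ∂/∂xᵢ`. -/
def eulerD : Deriv K ℓ := fun i => MvPolynomial.X i

/-- `A` is locally free: `A_X` is free for every `X ∈ L(A)` other than `∩_{H∈A} H`. -/
def LocallyFree (A : Finset (Submodule K (Fin ℓ → K))) : Prop :=
  ∀ X ∈ latticeOf ⊤ A, X ≠ A.inf id → IsFree (localize A X)

/-- Transport a finite set of subspaces contained in `T` to `K^m` along a linear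
isomorphism `T ≃ K^m`. -/
def transport {m : ℕ} (T : Submodule K (Fin ℓ → K)) (eqv : T ≃ₗ[K] (Fin m → K))
    (A : Finset (Submodule K (Fin ℓ → K))) : Finset (Submodule K (Fin m → K)) :=
  A.image fun L => (L.comap T.subtype).map eqv.toLinearMap

/-- An arrangement inside the subspace `T` is free with exponents `e`, i.e. it is free
after identifying `T` with a coordinate space. -/
def RestrFreeExp {m : ℕ} (T : Submodule K (Fin ℓ → K))
    (A : Finset (Submodule K (Fin ℓ → K))) (e : Fin m → ℕ) : Prop :=
  ∃ eqv : T ≃ₗ[K] (Fin m → K), IsFreeExp (transport T eqv A) e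

/-- The multiset of exponents. -/
def expMS {n : ℕ} (e : Fin n → ℕ) : Multiset ℕ := Finset.univ.val.map e

/-- `D(A)` has projective dimension at most 1: some finite generating set has a free
(possibly zero) syzygy module, i.e. there is a free resolution
`0 → S^m → S^n → D(A) → 0`. -/
def PdimLEOne (A : Finset (Submodule K (Fin ℓ → K))) : Prop :=
  ∃ (n m : ℕ) (θ : Fin n → Deriv K ℓ) (r : Fin m → Fin n → MvPolynomial (Fin ℓ) K),
    GeneratesD A θ ∧
    (∀ j, (∑ i, r j i • θ i) = 0) ∧
    (∀ c : Fin n → MvPolynomial (Fin ℓ) K, (∑ i, c i • θ i) = 0 →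
      ∃ q : Fin m → MvPolynomial (Fin ℓ) K, ∀ i, c i = ∑ j, q j * r j i) ∧
    (∀ q : Fin m → MvPolynomial (Fin ℓ) K, (∀ i, (∑ j, q j * r j i) = 0) → ∀ j, q j = 0)

/-- `A` has a free filtration `∅ = A₀ ⊂ A₁ ⊂ ⋯ ⊂ A_n = A`, `|A_i| = i`, each `A_i` free. -/
def HasFreeFiltration (A : Finset (Submodule K (Fin ℓ → K))) : Prop :=
  ∃ c : ℕ → Finset (Submodule K (Fin ℓ → K)),
    c A.card = A ∧ (∀ i ≤ A.card, (c i).card = i ∧ IsFree (c i)) ∧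
    ∀ i < A.card, c i ⊆ c (i + 1)

/-- The intersection lattices of `A` and `B` are isomorphic: there is a bijection of
hyperplanes preserving the rank of every subset (equivalently, a lattice isomorphism). -/
def LatticeEquiv (A B : Finset (Submodule K (Fin ℓ → K))) : Prop :=
  ∃ σ : Submodule K (Fin ℓ → K) → Submodule K (Fin ℓ → K),
    Set.BijOn σ ↑A ↑B ∧
    ∀ T ⊆ A, Module.finrank K ((T.inf id : Submodule K (Fin ℓ → K))) =
      Module.finrank K (((T.image σ).inf id : Submodule K (Fin ℓ → K)))



/-! ### Basic linear algebra of linear forms -/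

theorem linPoly_add (φ ψ : Module.Dual K (Fin ℓ → K)) :
    linPoly (φ + ψ) = linPoly φ + linPoly ψ := by
  simp [linPoly, add_mul, Finset.sum_add_distrib]

theorem linPoly_smul (c : K) (φ : Module.Dual K (Fin ℓ → K)) :
    linPoly (c • φ) = C c * linPoly φ := by
  simp [linPoly, mul_assoc, Finset.mul_sum]

theorem applyLin_addφ (θ : Deriv K ℓ) (φ ψ : Module.Dual K (Fin ℓ → K)) :
    applyLin θ (φ + ψ) = applyLin θ φ + applyLin θ ψ := by
  simp [applyLin, add_mul, Finset.sum_add_distrib]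

theorem applyLin_smulφ (θ : Deriv K ℓ) (c : K) (φ : Module.Dual K (Fin ℓ → K)) :
    applyLin θ (c • φ) = C c * applyLin θ φ := by
  simp [applyLin, mul_assoc, Finset.mul_sum]

theorem applyLin_add (θ η : Deriv K ℓ) (φ : Module.Dual K (Fin ℓ → K)) :
    applyLin (θ + η) φ = applyLin θ φ + applyLin η φ := by
  simp [applyLin, mul_add, Finset.sum_add_distrib]

theorem applyLin_sub (θ η : Deriv K ℓ) (φ : Module.Dual K (Fin ℓ → K)) :
    applyLin (θ - η) φ = applyLin θ φ - applyLin η φ := by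
  simp [applyLin, mul_sub, Finset.sum_sub_distrib]

theorem applyLin_smul (c : MvPolynomial (Fin ℓ) K) (θ : Deriv K ℓ)
    (φ : Module.Dual K (Fin ℓ → K)) :
    applyLin (c • θ) φ = c * applyLin θ φ := by
  simp [applyLin, Finset.mul_sum, mul_left_comm]

theorem applyLin_sum {ι : Type*} (s : Finset ι) (c : ι → MvPolynomial (Fin ℓ) K)
    (θ : ι → Deriv K ℓ) (φ : Module.Dual K (Fin ℓ → K)) :
    applyLin (∑ i ∈ s, c i • θ i) φ = ∑ i ∈ s, c i * applyLin (θ i) φ := by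
  induction s using Finset.induction_on with
  | empty => simp [applyLin]
  | insert a s ha ih => rw [Finset.sum_insert ha, Finset.sum_insert ha, applyLin_add,
      applyLin_smul, ih]

theorem dual_apply (φ : Module.Dual K (Fin ℓ → K)) (v : Fin ℓ → K) :
    φ v = ∑ i, φ (Pi.single i 1) * v i := by
  conv_lhs => rw [LinearMap.pi_apply_eq_sum_univ φ v]
  refine Finset.sum_congr rfl fun i _ => ?_
  rw [smul_eq_mul, mul_comm]
  congr 2
  ext j
  simp [Pi.single_apply, eq_comm]

/-- constant derivation -/
def constD (v : Fin ℓ → K) : Deriv K ℓ := fun i => C (v i)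

theorem applyLin_constD (v : Fin ℓ → K) (φ : Module.Dual K (Fin ℓ → K)) :
    applyLin (constD v) φ = C (φ v) := by
  rw [dual_apply φ v]
  simp [applyLin, constD]

theorem applyLin_eulerD (φ : Module.Dual K (Fin ℓ → K)) :
    applyLin (eulerD : Deriv K ℓ) φ = linPoly φ := rfl

theorem linPoly_homog (φ : Module.Dual K (Fin ℓ → K)) : (linPoly φ).IsHomogeneous 1 := by
  refine IsHomogeneous.sum _ _ _ fun i _ => ?_
  exact isHomogeneous_C_mul_X _ _

theorem applyLin_homog {θ : Deriv K ℓ} {n : ℕ} (h : HomogDeriv θ n)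
    (φ : Module.Dual K (Fin ℓ → K)) : (applyLin θ φ).IsHomogeneous n := by
  refine IsHomogeneous.sum _ _ _ fun i _ => ?_
  exact (h i).C_mul _

theorem constantCoeff_linPoly (φ : Module.Dual K (Fin ℓ → K)) :
    constantCoeff (linPoly φ) = 0 := by
  simp [linPoly]

theorem pderiv_linPoly (φ : Module.Dual K (Fin ℓ → K)) (k : Fin ℓ) :
    constantCoeff (pderiv k (linPoly φ)) = φ (Pi.single k 1) := by
  simp [linPoly, pderiv_X, Pi.single_apply]

theorem linPoly_eq_zero {φ : Module.Dual K (Fin ℓ → K)} (h : linPoly φ = 0) : φ = 0 := by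
  refine LinearMap.pi_ext' fun k => LinearMap.ext_ring ?_
  have := pderiv_linPoly φ k
  rw [h] at this
  simpa using this.symm

/-- Substitution along a linear map. -/
def sbst (π : (Fin ℓ → K) →ₗ[K] (Fin ℓ → K)) :
    MvPolynomial (Fin ℓ) K →ₐ[K] MvPolynomial (Fin ℓ) K :=
  aeval fun k => linPoly ((LinearMap.proj k : (Fin ℓ → K) →ₗ[K] K).comp π)

theorem sbst_X (π : (Fin ℓ → K) →ₗ[K] (Fin ℓ → K)) (k : Fin ℓ) :
    sbst π (X k) = linPoly ((LinearMap.proj k : (Fin ℓ → K) →ₗ[K] K).comp π) := by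
  simp [sbst]

theorem linPoly_sum {ι : Type*} (s : Finset ι) (f : ι → Module.Dual K (Fin ℓ → K)) :
    linPoly (∑ i ∈ s, f i) = ∑ i ∈ s, linPoly (f i) := by
  induction s using Finset.induction_on with
  | empty => simp [linPoly]
  | insert a s ha ih => rw [Finset.sum_insert ha, Finset.sum_insert ha, linPoly_add, ih]

theorem sbst_linPoly (π : (Fin ℓ → K) →ₗ[K] (Fin ℓ → K)) (φ : Module.Dual K (Fin ℓ → K)) :
    sbst π (linPoly φ) = linPoly (φ.comp π) := by
  have : φ.comp π = ∑ k, φ (Pi.single k 1) • ((LinearMap.proj k : (Fin ℓ → K) →ₗ[K] K).comp π) := by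
    ext1 v
    ext
    simp only [LinearMap.comp_apply, LinearMap.sum_apply, LinearMap.smul_apply, LinearMap.proj_apply,
      smul_eq_mul]
    rw [dual_apply φ]
  rw [this, linPoly_sum]
  conv_lhs => rw [linPoly]
  rw [map_sum]
  refine Finset.sum_congr rfl fun k _ => ?_
  rw [linPoly_smul, map_mul, sbst_X]
  congr 1
  exact (sbst π).commutes _

theorem constantCoeff_sbst (π : (Fin ℓ → K) →ₗ[K] (Fin ℓ → K)) (f : MvPolynomial (Fin ℓ) K) :
    constantCoeff (sbst π f) = constantCoeff f := by
  induction f using MvPolynomial.induction_on with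
  | C a => 
    have : sbst π (C a) = C a := (sbst π).commutes _
    rw [this]
  | add p q hp hq => simp [hp, hq]
  | mul_X p k hp => rw [map_mul, map_mul, sbst_X, constantCoeff_linPoly]; simp

theorem sbst_homog (π : (Fin ℓ → K) →ₗ[K] (Fin ℓ → K)) {f : MvPolynomial (Fin ℓ) K} {n : ℕ}
    (h : f.IsHomogeneous n) : (sbst π f).IsHomogeneous n := by
  have := h.aeval (fun k => linPoly ((LinearMap.proj k : (Fin ℓ → K) →ₗ[K] K).comp π)) (n := 1)
    (fun k => linPoly_homog _)
  rw [one_mul] at this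
  exact this

theorem sbst_comp (π π' : (Fin ℓ → K) →ₗ[K] (Fin ℓ → K)) (f : MvPolynomial (Fin ℓ) K) :
    sbst π (sbst π' f) = sbst (π'.comp π) f := by
  induction f using MvPolynomial.induction_on with
  | C a => 
    have : ∀ π : (Fin ℓ → K) →ₗ[K] (Fin ℓ → K), sbst π (C a) = C a := fun π => (sbst π).commutes _
    rw [this, this, this]
  | add p q hp hq => simp [hp, hq]
  | mul_X p k hp =>
    rw [map_mul, map_mul, map_mul, hp, sbst_X, sbst_X, sbst_linPoly]
    rfl

/-- `f - f ∘ π` lies in any ideal containing the linear forms `ψ - ψ ∘ π`. -/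
theorem sub_sbst_mem (π : (Fin ℓ → K) →ₗ[K] (Fin ℓ → K)) (P : Ideal (MvPolynomial (Fin ℓ) K))
    (hP : ∀ ψ : Module.Dual K (Fin ℓ → K), linPoly (ψ - ψ.comp π) ∈ P)
    (f : MvPolynomial (Fin ℓ) K) : f - sbst π f ∈ P := by
  induction f using MvPolynomial.induction_on with
  | C a => 
    have : sbst π (C a) = C a := (sbst π).commutes _
    rw [this]; simp
  | add p q hp hq =>
    rw [map_add, add_sub_add_comm]; exact P.add_mem hp hq
  | mul_X p k hp =>
    rw [map_mul]
    have h1 : (X k : MvPolynomial (Fin ℓ) K) - sbst π (X k) ∈ P := by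
      have := hP (LinearMap.proj k)
      rw [sub_eq_add_neg, ← neg_one_smul K, linPoly_add, linPoly_smul] at this
      have h2 : linPoly (LinearMap.proj k : (Fin ℓ → K) →ₗ[K] K) = X k := by
        simp [linPoly, Pi.single_apply, Finset.sum_ite_eq]
      rw [h2] at this
      rw [sbst_X]
      simpa [sub_eq_add_neg] using this
    have : p * X k - sbst π p * sbst π (X k) = (p - sbst π p) * X k
        + sbst π p * (X k - sbst π (X k)) := by ring
    rw [this]
    exact P.add_mem (P.mul_mem_right _ hp) (P.mul_mem_left _ h1)

/-- Retraction onto the hyperplane `ker α`. -/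
theorem exists_retraction (α : Module.Dual K (Fin ℓ → K)) (hα : α ≠ 0) :
    ∃ (v : Fin ℓ → K) (π : (Fin ℓ → K) →ₗ[K] (Fin ℓ → K)), α v = 1 ∧
      (∀ ψ : Module.Dual K (Fin ℓ → K), ψ.comp π = ψ - ψ v • α) ∧
      (∀ x, sbst π x = 0 ↔ linPoly α ∣ x) ∧ (∀ x, sbst π (sbst π x) = sbst π x) := by
  obtain ⟨w, hw⟩ : ∃ w, α w ≠ 0 := by
    by_contra! h
    exact hα (LinearMap.ext h)
  let v := (α w)⁻¹ • w
  have hv : α v = 1 := by simp [v, hw]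
  let π : (Fin ℓ → K) →ₗ[K] (Fin ℓ → K) := LinearMap.id - α.smulRight v
  have hπ : ∀ ψ : Module.Dual K (Fin ℓ → K), ψ.comp π = ψ - ψ v • α := by
    intro ψ
    refine LinearMap.ext fun x => ?_
    simp [π, mul_comm]
  have key : ∀ x, linPoly α ∣ x - sbst π x := by
    intro x
    rw [← Ideal.mem_span_singleton]
    apply sub_sbst_mem
    intro ψ
    rw [hπ, sub_sub_cancel, linPoly_smul]
    exact Ideal.mul_mem_left _ _ (Ideal.mem_span_singleton_self _)
  have h0 : sbst π (linPoly α) = 0 := by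
    rw [sbst_linPoly, hπ, hv]; simp [linPoly]
  have hker : ∀ x, linPoly α ∣ x → sbst π x = 0 := by
    rintro _ ⟨y, rfl⟩
    rw [map_mul, h0, zero_mul]
  refine ⟨v, π, hv, hπ, fun x => ⟨fun h => ?_, hker x⟩, fun x => ?_⟩
  · have := key x
    rwa [h, sub_zero] at this
  · have := hker _ (key x)
    rw [map_sub, sub_eq_zero] at this
    exact this.symm

theorem linPoly_prime {α : Module.Dual K (Fin ℓ → K)} (hα : α ≠ 0) : Prime (linPoly α) := by
  obtain ⟨v, π, -, -, h, -⟩ := exists_retraction α hα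
  refine ⟨fun h0 => hα (linPoly_eq_zero h0), fun hu => ?_, fun a b hab => ?_⟩
  · have := hu.map (constantCoeff : MvPolynomial (Fin ℓ) K →+* K)
    rw [constantCoeff_linPoly] at this
    simp at this
  · rw [← h, map_mul, mul_eq_zero] at hab
    rwa [← h, ← h]

theorem linPoly_dvd {α β : Module.Dual K (Fin ℓ → K)} (hα : α ≠ 0)
    (h : linPoly α ∣ linPoly β) : ∃ c : K, β = c • α := by
  obtain ⟨v, π, -, hπ, h', -⟩ := exists_retraction α hα
  rw [← h', sbst_linPoly, hπ] at h
  exact ⟨β v, sub_eq_zero.mp (linPoly_eq_zero h)⟩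

theorem linPoly_isRelPrime {α β : Module.Dual K (Fin ℓ → K)} (hα : α ≠ 0)
    (h : ∀ c : K, β ≠ c • α) : IsRelPrime (linPoly α) (linPoly β) := by
  rw [(linPoly_prime hα).irreducible.isRelPrime_iff_not_dvd]
  intro hd
  obtain ⟨c, hc⟩ := linPoly_dvd hα hd
  exact h c hc

theorem homComp_mul {B f : MvPolynomial (Fin ℓ) K} {d : ℕ} (hB : B.IsHomogeneous d) (k : ℕ) :
    homogeneousComponent (d + k) (B * f) = B * homogeneousComponent k f := by
  conv_lhs => rw [← sum_homogeneousComponent f, Finset.mul_sum, map_sum]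
  have : ∀ i, homogeneousComponent (d + k) (B * homogeneousComponent i f) =
      if i = k then B * homogeneousComponent i f else 0 := by
    intro i
    rw [homogeneousComponent_of_mem (hB.mul (homogeneousComponent_isHomogeneous i f))]
    simp [eq_comm]
  simp only [this]
  rw [Finset.sum_ite_eq']
  split_ifs with h
  · rfl
  · rw [homogeneousComponent_eq_zero, mul_zero]
    simpa using h

theorem homog_factor {B f : MvPolynomial (Fin ℓ) K} {d n : ℕ} (hB : B.IsHomogeneous d)
    (hB0 : B ≠ 0) (h : (B * f).IsHomogeneous n) (hf : f ≠ 0) :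
    d ≤ n ∧ f.IsHomogeneous (n - d) := by
  have h1 : ∀ k, d + k ≠ n → homogeneousComponent k f = 0 := by
    intro k hk
    have := homComp_mul hB k (f := f)
    rw [homogeneousComponent_of_mem h, if_neg (fun h => hk h)] at this
    exact (mul_eq_zero.mp this.symm).resolve_left hB0
  have hd : d ≤ n := by
    by_contra hlt
    apply hf
    rw [← sum_homogeneousComponent f]
    exact Finset.sum_eq_zero fun i _ => h1 i (by omega)
  refine ⟨hd, ?_⟩
  have : f = homogeneousComponent (n - d) f := by
    conv_lhs => rw [← sum_homogeneousComponent f]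
    refine Finset.sum_eq_single (n - d) (fun i _ hi => h1 i (by omega)) fun hi => ?_
    rw [homogeneousComponent_eq_zero]
    simp only [Finset.mem_range] at hi
    omega
  rw [this]
  exact homogeneousComponent_isHomogeneous _ _

theorem constantCoeff_homog {f : MvPolynomial (Fin ℓ) K} {n : ℕ} (h : f.IsHomogeneous n)
    (hn : n ≠ 0) : constantCoeff f = 0 := by
  rw [constantCoeff_eq]
  exact h.coeff_eq_zero (by simpa using hn.symm)

theorem eq_C_of_homog_zero {f : MvPolynomial (Fin ℓ) K} (h : f.IsHomogeneous 0) :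
    f = C (constantCoeff f) := by
  rw [constantCoeff_eq, ← homogeneousComponent_zero, homogeneousComponent_eq_self h]

/-! ### Arrangements indexed by natural numbers -/

/-- Logarithmic derivations for the forms `φ j`, `j ∈ I`. -/
def DI (φ : ℕ → Module.Dual K (Fin ℓ → K)) (I : Finset ℕ) (θ : Deriv K ℓ) : Prop :=
  ∀ j ∈ I, linPoly (φ j) ∣ applyLin θ (φ j)

/-- Non-minimal indices of the classes of `I` modulo `φ i`. -/
def Nset (φ : ℕ → Module.Dual K (Fin ℓ → K)) (I : Finset ℕ) (i : ℕ) : Finset ℕ :=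
  I.filter fun j => ∃ k ∈ I, k < j ∧ φ k ∈ Submodule.span K {φ i, φ j}

/-- The product of the forms in `Nset`. -/
def Bpol (φ : ℕ → Module.Dual K (Fin ℓ → K)) (I : Finset ℕ) (i : ℕ) : MvPolynomial (Fin ℓ) K :=
  ∏ j ∈ Nset φ I i, linPoly (φ j)

/-- The addition of `φ i` to `I` is a good one. -/
def Surj (φ : ℕ → Module.Dual K (Fin ℓ → K)) (I : Finset ℕ) (i : ℕ) : Prop :=
  ∃ θ : Deriv K ℓ, DI φ I θ ∧ ∃ u : MvPolynomial (Fin ℓ) K, constantCoeff u ≠ 0 ∧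
    linPoly (φ i) ∣ applyLin θ (φ i) - Bpol φ I i * u

/-- Pairwise independence. -/
def PW (φ : ℕ → Module.Dual K (Fin ℓ → K)) (I : Finset ℕ) : Prop :=
  (∀ j ∈ I, φ j ≠ 0) ∧ ∀ j ∈ I, ∀ k ∈ I, j ≠ k → ∀ c : K, φ k ≠ c • φ j

theorem PW.mono {φ : ℕ → Module.Dual K (Fin ℓ → K)} {I J : Finset ℕ} (h : PW φ J) (hIJ : I ⊆ J) :
    PW φ I :=
  ⟨fun j hj => h.1 j (hIJ hj), fun j hj k hk => h.2 j (hIJ hj) k (hIJ hk)⟩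

/-- A homogeneous basis of the logarithmic derivations. -/
def IsBas (φ : ℕ → Module.Dual K (Fin ℓ → K)) (I : Finset ℕ) (e : Fin ℓ → ℕ)
    (θ : Fin ℓ → Deriv K ℓ) : Prop :=
  (∀ l, HomogDeriv (θ l) (e l)) ∧ (∀ l, DI φ I (θ l)) ∧
    (∀ η, DI φ I η → ∃ c : Fin ℓ → MvPolynomial (Fin ℓ) K, η = ∑ l, c l • θ l) ∧ IndepD θ

theorem DI.smul {φ : ℕ → Module.Dual K (Fin ℓ → K)} {I : Finset ℕ} {θ : Deriv K ℓ}
    (h : DI φ I θ) (c : MvPolynomial (Fin ℓ) K) : DI φ I (c • θ) := fun j hj => by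
  rw [applyLin_smul]; exact (h j hj).mul_left c

theorem DI.sub {φ : ℕ → Module.Dual K (Fin ℓ → K)} {I : Finset ℕ} {θ η : Deriv K ℓ}
    (h : DI φ I θ) (h' : DI φ I η) : DI φ I (θ - η) := fun j hj => by
  rw [applyLin_sub]; exact dvd_sub (h j hj) (h' j hj)

theorem exists_vec (φ : ℕ → Module.Dual K (Fin ℓ → K)) (J : Finset ℕ)
    (α : Module.Dual K (Fin ℓ → K)) (h : α ∉ Submodule.span K (φ '' ↑J)) :
    ∃ v, (∀ j ∈ J, φ j v = 0) ∧ α v = 1 := by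
  have : ¬ (⨅ j : J, LinearMap.ker (φ j)) ≤ LinearMap.ker α := by
    intro hle
    apply h
    have := mem_span_of_iInf_ker_le_ker (L := fun j : J => φ j) hle
    convert this
    ext x; simp
  obtain ⟨w, hw, hw'⟩ := SetLike.not_le_iff_exists.mp this
  simp only [Submodule.mem_iInf, LinearMap.mem_ker, Subtype.forall] at hw hw'
  refine ⟨(α w)⁻¹ • w, fun j hj => ?_, ?_⟩
  · rw [map_smul, hw j hj, smul_zero]
  · rw [map_smul, smul_eq_mul, inv_mul_cancel₀ hw']

theorem Bpol_dvd {φ : ℕ → Module.Dual K (Fin ℓ → K)} {I : Finset ℕ} {i : ℕ}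
    (hPW : PW φ (insert i I)) (hi : i ∉ I)
    {v : Fin ℓ → K} {π : (Fin ℓ → K) →ₗ[K] (Fin ℓ → K)}
    (hπ : ∀ ψ : Module.Dual K (Fin ℓ → K), ψ.comp π = ψ - ψ v • φ i)
    (hz : ∀ x, sbst π x = 0 ↔ linPoly (φ i) ∣ x)
    {θ : Deriv K ℓ} (hθ : DI φ I θ) :
    sbst π (Bpol φ I i) ∣ sbst π (applyLin θ (φ i)) := by
  have hii : i ∈ insert i I := Finset.mem_insert_self _ _
  have hiI : ∀ {j}, j ∈ I → j ∈ insert i I := fun h => Finset.mem_insert_of_mem h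
  let cls : ℕ → Finset ℕ := fun j => I.filter fun k => φ k ∈ Submodule.span K {φ i, φ j}
  let rep : ℕ → ℕ := fun j => sInf (↑(cls j) : Set ℕ)
  have hrep : ∀ j ∈ Nset φ I i, rep j ∈ I ∧ φ (rep j) ∈ Submodule.span K {φ i, φ j} ∧ rep j < j := by
    intro j hj
    simp only [Nset, Finset.mem_filter] at hj
    obtain ⟨hjI, k, hk, hkj, hks⟩ := hj
    have hkc : k ∈ (↑(cls j) : Set ℕ) := by simp [cls, hk, hks]
    have hmem : rep j ∈ (↑(cls j) : Set ℕ) := Nat.sInf_mem ⟨k, hkc⟩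
    simp only [cls, Finset.coe_filter, Set.mem_ofPred_eq] at hmem
    exact ⟨hmem.1, hmem.2, lt_of_le_of_lt (Nat.sInf_le hkc) hkj⟩
  have hρ : ∀ j, sbst π (linPoly (φ j)) = linPoly (φ j - φ j v • φ i) := fun j => by
    rw [sbst_linPoly, hπ]
  have hne : ∀ j ∈ I, φ j - φ j v • φ i ≠ 0 := fun j hj h0 =>
    hPW.2 i hii j (hiI hj) (fun h => hi (h ▸ hj)) _ (sub_eq_zero.mp h0)
  rw [Bpol, map_prod, ← Finset.prod_fiberwise_of_maps_to
    (fun j hj => Finset.mem_image_of_mem rep hj)]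
  apply Finset.prod_dvd_of_isRelPrime
  · intro r hr r' hr' hrr'
    refine IsRelPrime.prod_left fun j hj => IsRelPrime.prod_right fun j' hj' => ?_
    simp only [Finset.mem_filter] at hj hj'
    have hjI : j ∈ I := (Finset.mem_filter.mp hj.1).1
    have hjI' : j' ∈ I := (Finset.mem_filter.mp hj'.1).1
    rw [hρ, hρ]
    apply linPoly_isRelPrime (hne j hjI)
    intro c hc
    apply hrr'
    rw [← hj.2, ← hj'.2]
    have hc0 : c ≠ 0 := by
      rintro rfl
      exact hne j' hjI' (by rw [hc, zero_smul])
    have hspan : Submodule.span K {φ i, φ j} = Submodule.span K {φ i, φ j'} := by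
      obtain ⟨t, e1⟩ : ∃ t : K, φ j' = t • φ i + c • φ j := by
        refine ⟨φ j' v - c * φ j v, ?_⟩
        have := sub_eq_iff_eq_add.mp hc
        generalize φ j' v = p at this ⊢
        generalize φ j v = q at this ⊢
        rw [this]; module
      have e2 : φ j = (-(c⁻¹ * t)) • φ i + c⁻¹ • φ j' := by
        rw [e1, smul_add, smul_smul, smul_smul, inv_mul_cancel₀ hc0]
        module
      apply le_antisymm <;> rw [Submodule.span_le] <;> rintro x (rfl | rfl)
      · exact Submodule.subset_span (by simp)
      · exact Submodule.mem_span_pair.mpr ⟨_, _, e2.symm⟩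
      · exact Submodule.subset_span (by simp)
      · exact Submodule.mem_span_pair.mpr ⟨_, _, e1.symm⟩
    simp only [rep, cls, hspan]
  · intro r hr
    obtain ⟨j0, hj0, hj0r⟩ := Finset.mem_image.mp hr
    have hrI : r ∈ I := hj0r ▸ (hrep j0 hj0).1
    obtain ⟨g, hg⟩ := hθ r hrI
    have h1 : sbst π (applyLin θ (φ i)) = sbst π (applyLin θ (φ i) - linPoly (φ i) * g) := by
      rw [map_sub, map_mul, (hz _).mpr (dvd_refl _), zero_mul, sub_zero]
    rw [h1, ← map_prod]
    apply map_dvd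
    apply Finset.prod_dvd_of_isRelPrime
    · intro j hj j' hj' hjj'
      have hj := Finset.mem_coe.mp hj
      have hj' := Finset.mem_coe.mp hj'
      have hjI : j ∈ I := (Finset.mem_filter.mp (Finset.mem_filter.mp hj).1).1
      have hjI' : j' ∈ I := (Finset.mem_filter.mp (Finset.mem_filter.mp hj').1).1
      exact linPoly_isRelPrime (hPW.1 j (hiI hjI)) (hPW.2 j (hiI hjI) j' (hiI hjI') hjj')
    · intro j hj
      obtain ⟨hjN, hjr⟩ := Finset.mem_filter.mp hj
      have hjI : j ∈ I := (Finset.mem_filter.mp hjN).1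
      obtain ⟨-, hs, hlt⟩ := hrep j hjN
      rw [hjr] at hs hlt
      obtain ⟨x, y, hxy⟩ := Submodule.mem_span_pair.mp hs
      have hx : x ≠ 0 := by
        rintro rfl
        rw [zero_smul, zero_add] at hxy
        exact hPW.2 j (hiI hjI) r (hiI hrI) hlt.ne' y hxy.symm
      rw [← hxy, applyLin_addφ, applyLin_smulφ, applyLin_smulφ, linPoly_add, linPoly_smul,
        linPoly_smul] at hg
      have h2 : linPoly (φ j) ∣ C x * (applyLin θ (φ i) - linPoly (φ i) * g) := by
        have : C x * (applyLin θ (φ i) - linPoly (φ i) * g) =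
            linPoly (φ j) * (C y * g) - C y * applyLin θ (φ j) := by
          linear_combination hg
        rw [this]
        exact dvd_sub (dvd_mul_right _ _) ((hθ j hjI).mul_left _)
      have hu : IsUnit (C x : MvPolynomial (Fin ℓ) K) := (Ne.isUnit hx).map C
      exact (hu.dvd_mul_left).mp h2

theorem sbst_Bpol_ne {φ : ℕ → Module.Dual K (Fin ℓ → K)} {I : Finset ℕ} {i : ℕ}
    (hPW : PW φ (insert i I)) (hi : i ∉ I)
    {v : Fin ℓ → K} {π : (Fin ℓ → K) →ₗ[K] (Fin ℓ → K)}
    (hπ : ∀ ψ : Module.Dual K (Fin ℓ → K), ψ.comp π = ψ - ψ v • φ i) :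
    sbst π (Bpol φ I i) ≠ 0 := by
  rw [Bpol, map_prod, Finset.prod_ne_zero_iff]
  intro j hj h0
  have hjI : j ∈ I := (Finset.mem_filter.mp hj).1
  rw [sbst_linPoly, hπ] at h0
  exact hPW.2 i (Finset.mem_insert_self _ _) j (Finset.mem_insert_of_mem hjI)
    (fun h => hi (h ▸ hjI)) _ (sub_eq_zero.mp (linPoly_eq_zero h0))

theorem Bpol_homog (φ : ℕ → Module.Dual K (Fin ℓ → K)) (I : Finset ℕ) (i : ℕ) :
    (Bpol φ I i).IsHomogeneous (Nset φ I i).card := by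
  have := IsHomogeneous.prod (Nset φ I i) (fun j => linPoly (φ j)) (fun _ => 1)
    (fun j _ => linPoly_homog _)
  simpa [Bpol] using this

/-- Data attached to a basis and an extra hyperplane. -/
structure Dat (φ : ℕ → Module.Dual K (Fin ℓ → K)) (I : Finset ℕ) (i : ℕ) (e : Fin ℓ → ℕ)
    (θ : Fin ℓ → Deriv K ℓ) (v : Fin ℓ → K) (π : (Fin ℓ → K) →ₗ[K] (Fin ℓ → K))
    (f : Fin ℓ → MvPolynomial (Fin ℓ) K) : Prop where
  hv : φ i v = 1
  hπ : ∀ ψ : Module.Dual K (Fin ℓ → K), ψ.comp π = ψ - ψ v • φ i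
  hz : ∀ x, sbst π x = 0 ↔ linPoly (φ i) ∣ x
  idem : ∀ x, sbst π (sbst π x) = sbst π x
  bas : IsBas φ I e θ
  B0 : sbst π (Bpol φ I i) ≠ 0
  hf : ∀ l, sbst π (applyLin (θ l) (φ i)) = sbst π (Bpol φ I i) * f l
  hfρ : ∀ l, sbst π (f l) = f l
  fhom : ∀ l, f l ≠ 0 → (Nset φ I i).card ≤ e l ∧ (f l).IsHomogeneous (e l - (Nset φ I i).card)

theorem exists_Dat {φ : ℕ → Module.Dual K (Fin ℓ → K)} {I : Finset ℕ} {i : ℕ}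
    (hPW : PW φ (insert i I)) (hi : i ∉ I) {e : Fin ℓ → ℕ} {θ : Fin ℓ → Deriv K ℓ}
    (hb : IsBas φ I e θ) : ∃ v π f, Dat φ I i e θ v π f := by
  obtain ⟨v, π, hv, hπ, hz, idem⟩ := exists_retraction (φ i) (hPW.1 i (Finset.mem_insert_self _ _))
  have hd : ∀ l, ∃ f, sbst π (applyLin (θ l) (φ i)) = sbst π (Bpol φ I i) * f :=
    fun l => Bpol_dvd hPW hi hπ hz (hb.2.1 l)
  choose f hf using hd
  have B0 := sbst_Bpol_ne hPW hi hπ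
  refine ⟨v, π, f, hv, hπ, hz, idem, hb, B0, hf, fun l => ?_, fun l hl => ?_⟩
  · have := congrArg (sbst π) (hf l)
    rw [map_mul, idem, idem, hf l] at this
    exact (mul_left_cancel₀ B0 this).symm
  · refine homog_factor (sbst_homog π (Bpol_homog φ I i)) B0 ?_ hl
    rw [← hf l]
    exact sbst_homog π (applyLin_homog (hb.1 l) _)

/-- Any element of `D` has its `f` in the ideal generated by the `f l`. -/
theorem Dat.expand {φ : ℕ → Module.Dual K (Fin ℓ → K)} {I : Finset ℕ} {i : ℕ} {e : Fin ℓ → ℕ}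
    {θ : Fin ℓ → Deriv K ℓ} {v : Fin ℓ → K} {π : (Fin ℓ → K) →ₗ[K] (Fin ℓ → K)}
    {f : Fin ℓ → MvPolynomial (Fin ℓ) K} (D : Dat φ I i e θ v π f)
    {c : Fin ℓ → MvPolynomial (Fin ℓ) K} {g : MvPolynomial (Fin ℓ) K}
    (h : sbst π (applyLin (∑ l, c l • θ l) (φ i)) = sbst π (Bpol φ I i) * g) :
    g = ∑ l, sbst π (c l) * f l := by
  apply mul_left_cancel₀ D.B0
  rw [← h, applyLin_sum, map_sum, Finset.mul_sum]
  refine Finset.sum_congr rfl fun l _ => ?_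
  rw [map_mul, D.hf]; ring

/-- `Surj` produces an index with a unit. -/
theorem Dat.surj {φ : ℕ → Module.Dual K (Fin ℓ → K)} {I : Finset ℕ} {i : ℕ} {e : Fin ℓ → ℕ}
    {θ : Fin ℓ → Deriv K ℓ} {v : Fin ℓ → K} {π : (Fin ℓ → K) →ₗ[K] (Fin ℓ → K)}
    {f : Fin ℓ → MvPolynomial (Fin ℓ) K} (D : Dat φ I i e θ v π f) (h : Surj φ I i) :
    ∃ k, constantCoeff (f k) ≠ 0 := by
  obtain ⟨η, hη, u, hu, hd⟩ := h
  obtain ⟨c, rfl⟩ := D.bas.2.2.1 η hη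
  rw [← D.hz, map_sub, sub_eq_zero, map_mul] at hd
  have := D.expand hd
  by_contra! h0
  apply hu
  rw [← constantCoeff_sbst π u, this, map_sum]
  exact Finset.sum_eq_zero fun l _ => by rw [map_mul, h0, mul_zero]

theorem Dat.unit_deg {φ : ℕ → Module.Dual K (Fin ℓ → K)} {I : Finset ℕ} {i : ℕ} {e : Fin ℓ → ℕ}
    {θ : Fin ℓ → Deriv K ℓ} {v : Fin ℓ → K} {π : (Fin ℓ → K) →ₗ[K] (Fin ℓ → K)}
    {f : Fin ℓ → MvPolynomial (Fin ℓ) K} (D : Dat φ I i e θ v π f) {k : Fin ℓ}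
    (hk : constantCoeff (f k) ≠ 0) :
    e k = (Nset φ I i).card ∧ f k = C (constantCoeff (f k)) := by
  have h0 : f k ≠ 0 := fun h => hk (by rw [h, map_zero])
  obtain ⟨h1, h2⟩ := D.fhom k h0
  by_cases h3 : e k - (Nset φ I i).card = 0
  · rw [h3] at h2
    exact ⟨by omega, eq_C_of_homog_zero h2⟩
  · exact absurd (constantCoeff_homog h2 h3) hk

theorem Dat.surj' {φ : ℕ → Module.Dual K (Fin ℓ → K)} {I : Finset ℕ} {i : ℕ} {e : Fin ℓ → ℕ}
    {θ : Fin ℓ → Deriv K ℓ} {v : Fin ℓ → K} {π : (Fin ℓ → K) →ₗ[K] (Fin ℓ → K)}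
    {f : Fin ℓ → MvPolynomial (Fin ℓ) K} (D : Dat φ I i e θ v π f) {k : Fin ℓ}
    (hk : constantCoeff (f k) ≠ 0) : Surj φ I i := by
  refine ⟨θ k, D.bas.2.1 k, f k, hk, ?_⟩
  rw [← D.hz, map_sub, map_mul, D.hfρ, D.hf, sub_self]

/-! ### Exchange of bases -/

theorem Dat.exchange {φ : ℕ → Module.Dual K (Fin ℓ → K)} {I : Finset ℕ} {i : ℕ} {e : Fin ℓ → ℕ}
    {θ : Fin ℓ → Deriv K ℓ} {v : Fin ℓ → K} {π : (Fin ℓ → K) →ₗ[K] (Fin ℓ → K)}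
    {f : Fin ℓ → MvPolynomial (Fin ℓ) K} (D : Dat φ I i e θ v π f) {k : Fin ℓ}
    (hk : constantCoeff (f k) ≠ 0) :
    ∃ θ', IsBas φ (insert i I) (Function.update e k (e k + 1)) θ' := by
  obtain ⟨hek, hfk⟩ := D.unit_deg hk
  set c0 := constantCoeff (f k) with hc0
  let w : Fin ℓ → MvPolynomial (Fin ℓ) K := fun l => C c0⁻¹ * f l
  have hCρ : ∀ c : K, sbst π (C c) = C c := fun c => (sbst π).commutes _
  have hwk : w k = 1 := by
    simp only [w]
    rw [hfk, ← C_mul, inv_mul_cancel₀ hk, C_1]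
  let a := linPoly (φ i)
  have ha : sbst π a = 0 := (D.hz _).mpr (dvd_refl _)
  have ha0 : a ≠ 0 := by
    intro h
    have := linPoly_eq_zero h
    have hv := D.hv
    rw [this] at hv
    simp at hv
  let θ' : Fin ℓ → Deriv K ℓ := fun l => if l = k then a • θ k else θ l - w l • θ k
  have hθk : θ' k = a • θ k := by simp [θ']
  have hθl : ∀ l, l ≠ k → θ' l = θ l - w l • θ k := fun l hl => by simp [θ', hl]
  refine ⟨θ', fun l => ?_, fun l => ?_, fun η hη => ?_, fun c hc => ?_⟩
  · by_cases hl : l = k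
    · subst hl
      rw [hθk, Function.update_self]
      intro m
      have := (linPoly_homog (φ i)).mul (D.bas.1 l m)
      rw [add_comm] at this
      exact this
    · rw [hθl l hl, Function.update_of_ne hl]
      intro m
      refine (D.bas.1 l m).sub ?_
      by_cases hfl : f l = 0
      · simp only [w, hfl, mul_zero, zero_smul]
        exact isHomogeneous_zero _ _ _
      · obtain ⟨h1, h2⟩ := D.fhom l hfl
        have := (h2.C_mul c0⁻¹).mul (D.bas.1 k m)
        rw [hek, Nat.sub_add_cancel h1] at this
        exact this
  · intro j hj
    rcases Finset.mem_insert.mp hj with rfl | hj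
    · by_cases hl : l = k
      · subst hl
        rw [hθk, applyLin_smul]
        exact dvd_mul_right _ _
      · rw [hθl l hl, ← D.hz, applyLin_sub, applyLin_smul, map_sub, map_mul, D.hf, D.hf]
        have : sbst π (w l) = C c0⁻¹ * f l := by
          simp only [w]; rw [map_mul, hCρ, D.hfρ]
        have h2 : C c0⁻¹ * C c0 = (1 : MvPolynomial (Fin ℓ) K) := by
          rw [← C_mul, inv_mul_cancel₀ hk, C_1]
        rw [this, hfk]
        linear_combination (- sbst π (Bpol φ I j) * f l) * h2
    · by_cases hl : l = k
      · subst hl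
        rw [hθk]
        exact (D.bas.2.1 l).smul a j hj
      · rw [hθl l hl]
        exact (D.bas.2.1 l).sub ((D.bas.2.1 k).smul (w l)) j hj
  · obtain ⟨c, hc⟩ := D.bas.2.2.1 η fun j hj => hη j (Finset.mem_insert_of_mem hj)
    have h0 : sbst π (applyLin (∑ l, c l • θ l) (φ i)) = sbst π (Bpol φ I i) * 0 := by
      rw [← hc, mul_zero, D.hz]
      exact hη i (Finset.mem_insert_self _ _)
    have h1 := D.expand h0
    have h2 : a ∣ ∑ l, c l * w l := by
      rw [← D.hz, map_sum]
      have : ∀ l, sbst π (c l * w l) = C c0⁻¹ * (sbst π (c l) * f l) := fun l => by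
        simp only [w]
        rw [map_mul, map_mul, hCρ, D.hfρ]; ring
      simp only [this]
      rw [← Finset.mul_sum, ← h1, mul_zero]
    obtain ⟨t, ht⟩ := h2
    refine ⟨Function.update c k t, ?_⟩
    have h3 : ∀ l, Function.update c k t l • θ' l = (c l • θ l - (c l * w l) • θ k)
        + (if l = k then (∑ l, c l * w l) • θ k else 0) := by
      intro l
      by_cases hl : l = k
      · subst hl
        rw [hθk, Function.update_self, hwk, if_pos rfl, mul_one, sub_self, zero_add, ht, smul_smul,
          mul_comm]
      · rw [hθl l hl, Function.update_of_ne hl, if_neg hl, add_zero, smul_sub, smul_smul]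
    rw [Finset.sum_congr rfl fun l _ => h3 l, Finset.sum_add_distrib, Finset.sum_sub_distrib,
      ← Finset.sum_smul, Finset.sum_ite_eq' Finset.univ k, if_pos (Finset.mem_univ _), ← hc,
      sub_add_cancel]
  · let d : Fin ℓ → MvPolynomial (Fin ℓ) K := fun l => if l = k then
      c k * a - ∑ m, (if m = k then 0 else c m * w m) else c l
    have h3 : ∀ l, c l • θ' l = (d l • θ l + (if l = k then
        (∑ m, (if m = k then 0 else c m * w m)) • θ k else 0)) -
        (if l = k then 0 else c l * w l) • θ k := by
      intro l
      by_cases hl : l = k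
      · subst hl
        simp only [d, if_true]
        rw [hθk, zero_smul, sub_zero, sub_smul, sub_add_cancel, smul_smul]
      · simp only [d, if_neg hl]
        rw [hθl l hl, add_zero, smul_sub, smul_smul]
    have h4 : ∑ l, d l • θ l = 0 := by
      rw [Finset.sum_congr rfl fun l _ => h3 l, Finset.sum_sub_distrib, Finset.sum_add_distrib,
        ← Finset.sum_smul, Finset.sum_ite_eq' Finset.univ k, if_pos (Finset.mem_univ _),
        add_sub_cancel_right] at hc
      exact hc
    have h5 := D.bas.2.2.2 d h4
    have h6 : ∀ l, l ≠ k → c l = 0 := fun l hl => by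
      have := h5 l
      simpa only [d, if_neg hl] using this
    have h7 := h5 k
    simp only [d, if_true] at h7
    rw [Finset.sum_eq_zero (fun m _ => by
      by_cases hm : m = k
      · rw [if_pos hm]
      · rw [if_neg hm, h6 m hm, zero_mul]), sub_zero] at h7
    intro l
    by_cases hl : l = k
    · rw [hl]; exact (mul_eq_zero.mp h7).resolve_right ha0
    · exact h6 l hl

/-! ### Localization -/

theorem exists_proj (φ : ℕ → Module.Dual K (Fin ℓ → K)) (J : Finset ℕ) :
    ∃ π : (Fin ℓ → K) →ₗ[K] (Fin ℓ → K), (∀ j ∈ J, (φ j).comp π = 0) ∧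
      (∀ α : Module.Dual K (Fin ℓ → K), α ∉ Submodule.span K (φ '' ↑J) → α.comp π ≠ 0) := by
  let W : Submodule K (Fin ℓ → K) := ⨅ j : J, LinearMap.ker (φ j)
  obtain ⟨g, hg⟩ := LinearMap.exists_leftInverse_of_injective W.subtype (by simp)
  refine ⟨W.subtype.comp g, fun j hj => ?_, fun α hα h0 => ?_⟩
  · refine LinearMap.ext fun x => ?_
    have := (g x).2
    simp only [W, Submodule.mem_iInf, LinearMap.mem_ker, Subtype.forall] at this
    exact this j hj
  · obtain ⟨v, hv, hv1⟩ := exists_vec φ J α hα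
    have hvW : v ∈ W := by
      simp only [W, Submodule.mem_iInf, LinearMap.mem_ker, Subtype.forall]
      exact hv
    have h1 := LinearMap.congr_fun hg ⟨v, hvW⟩
    have h2 := LinearMap.congr_fun h0 v
    simp only [LinearMap.comp_apply, Submodule.subtype_apply, LinearMap.id_apply] at h1 h2
    rw [h1] at h2
    simp [hv1] at h2

/-- Translation with generic parameters. -/
def trans (π : (Fin ℓ → K) →ₗ[K] (Fin ℓ → K)) :
    MvPolynomial (Fin ℓ) K →ₐ[K] MvPolynomial (Fin ℓ) (MvPolynomial (Fin ℓ) K) :=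
  aeval fun k => C (X k) + map C (linPoly ((LinearMap.proj k : (Fin ℓ → K) →ₗ[K] K).comp π))

theorem trans_C (π : (Fin ℓ → K) →ₗ[K] (Fin ℓ → K)) (c : K) : trans π (C c) = C (C c) :=
  (trans π).commutes c

theorem trans_linPoly (π : (Fin ℓ → K) →ₗ[K] (Fin ℓ → K)) (φ : Module.Dual K (Fin ℓ → K)) :
    trans π (linPoly φ) = C (linPoly φ) + map C (linPoly (φ.comp π)) := by
  have h1 : sbst π (linPoly φ) = ∑ k, C (φ (Pi.single k 1)) * sbst π (X k) := by
    rw [linPoly, map_sum]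
    refine Finset.sum_congr rfl fun k _ => ?_
    rw [map_mul]
    congr 1
    exact (sbst π).commutes _
  rw [← sbst_linPoly, h1]
  simp only [sbst_X]
  rw [linPoly, map_sum, map_sum, map_sum, ← Finset.sum_add_distrib]
  refine Finset.sum_congr rfl fun k _ => ?_
  rw [map_mul, map_mul, map_mul, trans_C, map_C, ← mul_add]
  congr 1
  simp [trans]

theorem map_trans (π : (Fin ℓ → K) →ₗ[K] (Fin ℓ → K)) (f : MvPolynomial (Fin ℓ) K) :
    map constantCoeff (trans π f) = sbst π f := by
  have hcc : (constantCoeff : MvPolynomial (Fin ℓ) K →+* K).comp C = RingHom.id K := by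
    ext; simp
  induction f using MvPolynomial.induction_on with
  | C a =>
    have : sbst π (C a) = C a := (sbst π).commutes _
    rw [this, trans_C, map_C, constantCoeff_C]
  | add p q hp hq => simp only [map_add, hp, hq]
  | mul_X p k hp =>
    rw [map_mul, map_mul, map_mul, hp, sbst_X]
    congr 1
    simp only [trans, aeval_X, map_add, map_C, constantCoeff_X, map_zero, zero_add, map_map]
    rw [hcc, map_id]

theorem Surj.localize {φ : ℕ → Module.Dual K (Fin ℓ → K)} {I F : Finset ℕ} {i : ℕ}
    (hF : F ⊆ I)
    (hflat : ∀ j ∈ I, φ j ∈ Submodule.span K (φ '' ↑(insert i F)) → j ∈ F)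
    (h : Surj φ I i) : Surj φ F i := by
  obtain ⟨θ, hθ, u, hu, q, hq⟩ := h
  have hN : Nset φ F i = (Nset φ I i).filter (· ∈ F) := by
    ext j
    simp only [Nset, Finset.mem_filter]
    constructor
    · rintro ⟨hj, k, hk, h1, h2⟩
      exact ⟨⟨hF hj, k, hF hk, h1, h2⟩, hj⟩
    · rintro ⟨⟨-, k, hk, h1, h2⟩, hj⟩
      refine ⟨hj, k, hflat k hk (Submodule.span_mono ?_ h2), h1, h2⟩
      rintro x (rfl | rfl)
      · exact ⟨i, by simp, rfl⟩
      · exact ⟨j, by simp [hj], rfl⟩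
  let w := (∏ j ∈ (Nset φ I i).filter (¬ · ∈ F), linPoly (φ j)) * u
  have hB : Bpol φ I i * u = Bpol φ F i * w := by
    simp only [w]
    rw [Bpol, Bpol, hN, ← mul_assoc, Finset.prod_filter_mul_prod_filter_not]
  rw [hB, sub_eq_iff_eq_add] at hq
  obtain ⟨π, hπ0, hπ1⟩ := exists_proj φ (insert i F)
  have hT : ∀ j ∈ insert i F, trans π (linPoly (φ j)) = C (linPoly (φ j)) := fun j hj => by
    rw [trans_linPoly, hπ0 j hj]; simp [linPoly]
  have hw : sbst π w ≠ 0 := by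
    simp only [w]
    rw [map_mul, map_prod]
    refine mul_ne_zero (Finset.prod_ne_zero_iff.mpr fun j hj h0 => ?_) fun h0 => ?_
    · obtain ⟨h1, h2⟩ := Finset.mem_filter.mp hj
      rw [sbst_linPoly] at h0
      exact hπ1 (φ j) (fun h3 => h2 (hflat j (Finset.mem_filter.mp h1).1 h3)) (linPoly_eq_zero h0)
    · apply hu
      rw [← constantCoeff_sbst π, h0, map_zero]
  obtain ⟨m, hm⟩ : ∃ m, constantCoeff (coeff m (trans π w)) ≠ 0 := by
    by_contra! h0
    apply hw
    ext m
    rw [← map_trans, coeff_map, h0, coeff_zero]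
  let θ' : Deriv K ℓ := fun k => coeff m (trans π (θ k))
  have hθ' : ∀ ψ : Module.Dual K (Fin ℓ → K), applyLin θ' ψ = coeff m (trans π (applyLin θ ψ)) := by
    intro ψ
    simp only [applyLin, map_sum, coeff_sum, map_mul, trans_C, coeff_C_mul, θ']
  refine ⟨θ', fun j hj => ?_, coeff m (trans π w), hm, coeff m (trans π q), ?_⟩
  · obtain ⟨g, hg⟩ := hθ j (hF hj)
    rw [hθ', hg, map_mul, hT j (Finset.mem_insert_of_mem hj), coeff_C_mul]
    exact dvd_mul_right _ _
  · have hTB : trans π (Bpol φ F i) = C (Bpol φ F i) := by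
      rw [Bpol, map_prod, map_prod]
      exact Finset.prod_congr rfl fun j hj =>
        hT j (Finset.mem_insert_of_mem (Finset.mem_filter.mp hj).1)
    rw [hθ', hq, map_add, map_mul, map_mul, hTB, hT i (Finset.mem_insert_self _ _), coeff_add,
      coeff_C_mul, coeff_C_mul, add_sub_cancel_right]

/-! ### Two consecutive free arrangements -/

theorem gcd_aux {ι : Type} (β : ι → MvPolynomial (Fin ℓ) K) (R : Finset ι)
    (n f : MvPolynomial (Fin ℓ) K) (hp : ∀ r ∈ R, Prime (β r))
    (hd : ∀ r ∈ R, ∀ k ∈ R, r ≠ k → ¬ β r ∣ β k)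
    (h0 : f ∣ n * ∏ r ∈ R, β r) (h1 : ∀ r ∈ R, f ∣ n * ∏ k ∈ R.erase r, β k) : f ∣ n := by
  have key : ∀ T : Finset ι, T ⊆ R → f ∣ n * ∏ k ∈ R \ T, β k := by
    intro T
    induction T using Finset.induction_on with
    | empty => intro _; simpa using h0
    | insert t T ht ih =>
      intro hT
      have htR : t ∈ R := hT (Finset.mem_insert_self _ _)
      have hTR : T ⊆ R := fun x hx => hT (Finset.mem_insert_of_mem hx)
      obtain ⟨x, hx⟩ := ih hTR
      obtain ⟨y, hy⟩ := h1 t htR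
      have e1 : ∏ k ∈ R \ T, β k = β t * ∏ k ∈ R \ insert t T, β k := by
        rw [← Finset.prod_insert (by simp)]
        congr 1
        ext z
        by_cases hz : z = t
        · subst hz; simp [htR, ht]
        · simp [hz]
      have e2 : ∏ k ∈ R.erase t, β k = (∏ k ∈ R \ insert t T, β k) * ∏ k ∈ T, β k := by
        rw [← Finset.prod_union]
        · congr 1
          ext z
          by_cases hz : z = t
          · subst hz; simp [ht]
          · simp only [Finset.mem_erase, Finset.mem_union, Finset.mem_sdiff, Finset.mem_insert]
            constructor
            · rintro ⟨-, h⟩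
              by_cases hzT : z ∈ T
              · exact Or.inr hzT
              · exact Or.inl ⟨h, by tauto⟩
            · rintro (h | h)
              · exact ⟨hz, h.1⟩
              · exact ⟨hz, hTR h⟩
        · rw [Finset.disjoint_left]
          intro z hz hz'
          simp [hz'] at hz
      rw [e1] at hx
      rw [e2] at hy
      set P := ∏ k ∈ R \ insert t T, β k
      by_cases hf : f = 0
      · rw [hf, zero_mul] at hx
        have : n * P = 0 := by
          have h2 : β t * (n * P) = 0 := by linear_combination hx
          exact (mul_eq_zero.mp h2).resolve_left (hp t htR).ne_zero
        rw [this]; exact dvd_zero _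
      · have h3 : β t * y = x * ∏ k ∈ T, β k := by
          apply mul_left_cancel₀ hf
          linear_combination (- β t) * hy + (∏ k ∈ T, β k) * hx
        have h4 : β t ∣ x := by
          rcases (hp t htR).dvd_or_dvd (Dvd.intro _ h3) with h | h
          · exact h
          · exfalso
            obtain ⟨k, hk, hk'⟩ := (hp t htR).exists_mem_finset_dvd h
            exact hd t htR k (hTR hk) (fun h => ht (h ▸ hk)) hk'
        obtain ⟨z, hz⟩ := h4
        refine ⟨z, mul_left_cancel₀ (hp t htR).ne_zero ?_⟩
        rw [hz] at hx
        linear_combination hx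
  simpa using key R subset_rfl

theorem exists_unit_entry (N : Matrix (Fin ℓ) (Fin ℓ) (MvPolynomial (Fin ℓ) K))
    (m : MvPolynomial (Fin ℓ) K) (α : Module.Dual K (Fin ℓ → K)) (v : Fin ℓ → K) (hv : α v = 1)
    (h : N.det * m * linPoly α = linPoly α ^ ℓ) : ∃ l j, constantCoeff (N l j) ≠ 0 := by
  by_contra! h0
  let τ : MvPolynomial (Fin ℓ) K →ₐ[K] Polynomial K :=
    aeval fun k => Polynomial.C (v k) * Polynomial.X
  have hτ : ∀ f, (τ f).coeff 0 = constantCoeff f := by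
    intro f
    have : (Polynomial.constantCoeff.comp (τ : MvPolynomial (Fin ℓ) K →+* Polynomial K)) =
        constantCoeff := by
      apply MvPolynomial.ringHom_ext
      · intro r
        have : τ (C r) = Polynomial.C r := τ.commutes r
        simp [this]
      · intro k; simp [τ]
    exact RingHom.congr_fun this f
  have hτa : τ (linPoly α) = Polynomial.X := by
    have hC : ∀ r, τ (C r) = Polynomial.C r := fun r => τ.commutes r
    simp only [linPoly, map_sum, map_mul, hC]
    have : ∀ k, τ (X k) = Polynomial.C (v k) * Polynomial.X := fun k => by simp [τ]
    simp only [this, ← mul_assoc, ← Polynomial.C_mul]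
    rw [← Finset.sum_mul, ← map_sum, ← dual_apply, hv, Polynomial.C_1, one_mul]
  have hd : ∀ l j, ∃ g, τ (N l j) = Polynomial.X * g := fun l j => by
    have : Polynomial.X ∣ τ (N l j) := Polynomial.X_dvd_iff.mpr (by rw [hτ, h0])
    exact this
  choose g hg using hd
  have h1 : τ N.det = Polynomial.X ^ ℓ * (Matrix.of g).det := by
    have e : τ.mapMatrix N = (Polynomial.X : Polynomial K) • Matrix.of g := by
      ext1 l j
      simp [hg]
    rw [AlgHom.map_det, e, Matrix.det_smul, Fintype.card_fin]
  have h2 := congrArg τ h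
  rw [map_mul, map_mul, map_pow, hτa, h1] at h2
  have h3 : (Polynomial.X : Polynomial K) ^ (ℓ + 1) ∣ Polynomial.X ^ ℓ := by
    rw [← h2, pow_succ]
    exact ⟨(Matrix.of g).det * τ m, by ring⟩
  rw [Polynomial.X_pow_dvd_iff] at h3
  have := h3 ℓ (by omega)
  simp at this

theorem DI_prod {φ : ℕ → Module.Dual K (Fin ℓ → K)} {I T : Finset ℕ} {w : Fin ℓ → K}
    (h : ∀ j ∈ I, j ∉ T → φ j w = 0) : DI φ I ((∏ k ∈ T, linPoly (φ k)) • constD w) := by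
  intro j hj
  rw [applyLin_smul, applyLin_constD]
  by_cases hjT : j ∈ T
  · exact (Finset.dvd_prod_of_mem _ hjT).mul_right _
  · rw [h j hj hjT]; simp

theorem surj_of_bas {φ : ℕ → Module.Dual K (Fin ℓ → K)} {I : Finset ℕ} {i : ℕ}
    (hPW : PW φ (insert i I)) (hi : i ∉ I) {e e' : Fin ℓ → ℕ} {θ η : Fin ℓ → Deriv K ℓ}
    (hb : IsBas φ I e θ) (hb' : IsBas φ (insert i I) e' η) : Surj φ I i := by
  obtain ⟨v, π, f, D⟩ := exists_Dat hPW hi hb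
  set a := linPoly (φ i) with ha
  let g : Fin ℓ → MvPolynomial (Fin ℓ) K := fun l => applyLin (θ l) (φ i)
  have hii : i ∈ insert i I := Finset.mem_insert_self _ _
  have hiI : ∀ {j}, j ∈ I → j ∈ insert i I := fun h => Finset.mem_insert_of_mem h
  have ha0 : a ≠ 0 := fun h => hPW.1 i hii (linPoly_eq_zero h)
  have hρ : ∀ j, sbst π (linPoly (φ j)) = linPoly (φ j - φ j v • φ i) := fun j => by
    rw [sbst_linPoly, D.hπ]
  have hne : ∀ j ∈ I, φ j - φ j v • φ i ≠ 0 := fun j hj h0 =>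
    hPW.2 i hii j (hiI hj) (fun h => hi (h ▸ hj)) _ (sub_eq_zero.mp h0)
  have hM : ∀ j, ∃ c : Fin ℓ → MvPolynomial (Fin ℓ) K, η j = ∑ l, c l • θ l := fun j =>
    hb.2.2.1 _ fun k hk => hb'.2.1 j k (hiI hk)
  choose M hM using hM
  have hN : ∀ l, ∃ c : Fin ℓ → MvPolynomial (Fin ℓ) K, a • θ l = ∑ j, c j • η j := fun l =>
    hb'.2.2.1 _ fun k hk => by
      rcases Finset.mem_insert.mp hk with rfl | hk
      · rw [applyLin_smul]; exact dvd_mul_right _ _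
      · exact (hb.2.1 l).smul a k hk
  choose N hN using hN
  have hNM : (Matrix.of N) * (Matrix.of M) = a • (1 : Matrix (Fin ℓ) (Fin ℓ) _) := by
    ext1 l m
    have h1 : ∑ m, ((Matrix.of N * Matrix.of M) l m - if l = m then a else 0) • θ m = 0 := by
      simp only [sub_smul, Finset.sum_sub_distrib, ite_smul, zero_smul, Finset.sum_ite_eq,
        Finset.mem_univ, if_true]
      rw [hN l, sub_eq_zero]
      simp only [hM, Finset.smul_sum, Matrix.mul_apply, Matrix.of_apply, Finset.sum_smul, smul_smul]
      exact Finset.sum_comm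
    have h2 := hb.2.2.2 _ h1 m
    rw [sub_eq_zero.mp h2]
    simp [Matrix.one_apply]
  have hg0 : ∃ l, sbst π (g l) ≠ 0 := by
    by_contra! h0
    obtain ⟨c, hc⟩ := hb.2.2.1 _ (DI_prod (φ := φ) (I := I) (T := I) (w := v)
      (fun j h1 h2 => absurd h1 h2))
    have h1 := congrArg (fun t => sbst π (applyLin t (φ i))) hc
    simp only [applyLin_sum, applyLin_smul, applyLin_constD, D.hv, map_sum, map_mul] at h1
    rw [Finset.sum_eq_zero fun l _ => by rw [show sbst π (applyLin (θ l) (φ i)) = 0 from h0 l,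
      mul_zero], C_1, map_one, mul_one, map_prod, Finset.prod_eq_zero_iff] at h1
    obtain ⟨k, hk, hk0⟩ := h1
    rw [hρ] at hk0
    exact hne k hk (linPoly_eq_zero hk0)
  have hdetM : a ∣ (Matrix.of M).det := by
    rw [← D.hz, AlgHom.map_det, ← Matrix.exists_mulVec_eq_zero_iff]
    refine ⟨fun l => sbst π (g l), fun h => ?_, ?_⟩
    · obtain ⟨l, hl⟩ := hg0
      exact hl (congrFun h l)
    · ext1 j
      have h1 : a ∣ applyLin (η j) (φ i) := hb'.2.1 j i hii
      rw [← D.hz, hM j, applyLin_sum, map_sum] at h1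
      simp only [map_mul] at h1
      simpa [Matrix.mulVec, dotProduct] using h1
  obtain ⟨m, hm⟩ := hdetM
  obtain ⟨l0, j0, hn⟩ : ∃ l j, constantCoeff (N l j) ≠ 0 := by
    refine exists_unit_entry (Matrix.of N) m (φ i) v D.hv ?_
    have := congrArg Matrix.det hNM
    rw [Matrix.det_mul, Matrix.det_smul, Matrix.det_one, mul_one, Fintype.card_fin, hm] at this
    rw [← this]; ring
  have hdiv : ∀ l, f l0 ∣ sbst π (N l0 j0) * f l := by
    intro l
    obtain ⟨d, hd⟩ := hb'.2.2.1 (g l • θ l0 - g l0 • θ l) fun k hk => by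
      rcases Finset.mem_insert.mp hk with rfl | hk
      · rw [applyLin_sub, applyLin_smul, applyLin_smul]
        simp only [g]
        rw [mul_comm, sub_self]; exact dvd_zero _
      · exact ((hb.2.1 l0).smul (g l)).sub ((hb.2.1 l).smul (g l0)) k hk
    have h1 : ∑ j, (g l * N l0 j - g l0 * N l j - a * d j) • η j = 0 := by
      simp only [sub_smul, mul_smul, Finset.sum_sub_distrib, ← Finset.smul_sum]
      rw [← hN, ← hN, ← hd, smul_sub, sub_eq_zero, smul_comm a (g l), smul_comm a (g l0)]
    have h2 := congrArg (sbst π) (hb'.2.2.2 _ h1 j0)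
    have haρ : sbst π a = 0 := (D.hz _).mpr (dvd_refl _)
    simp only [map_sub, map_mul, haρ, zero_mul, sub_zero, map_zero, g, D.hf] at h2
    refine ⟨sbst π (N l j0), mul_left_cancel₀ D.B0 ?_⟩
    linear_combination h2
  have hdiv' : ∀ (ζ : Deriv K ℓ) (q : MvPolynomial (Fin ℓ) K), DI φ I ζ →
      sbst π (applyLin ζ (φ i)) = sbst π (Bpol φ I i) * q → f l0 ∣ sbst π (N l0 j0) * q := by
    intro ζ q hζ hq
    obtain ⟨c, rfl⟩ := hb.2.2.1 ζ hζ
    rw [D.expand hq, Finset.mul_sum]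
    refine Finset.dvd_sum fun l _ => ?_
    rw [mul_left_comm]
    exact (hdiv l).mul_left _
  have hNsub : Nset φ I i ⊆ I := Finset.filter_subset _ _
  have hfin : f l0 ∣ sbst π (N l0 j0) := by
    refine gcd_aux (fun r => sbst π (linPoly (φ r))) (I \ Nset φ I i) _ _ (fun r hr => ?_)
      (fun r hr k hk hrk hdv => ?_) ?_ (fun r hr => ?_)
    · rw [hρ]; exact linPoly_prime (hne r (Finset.mem_sdiff.mp hr).1)
    · simp only [hρ] at hdv
      obtain ⟨hrI, hrN⟩ := Finset.mem_sdiff.mp hr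
      obtain ⟨hkI, hkN⟩ := Finset.mem_sdiff.mp hk
      obtain ⟨c, hc⟩ := linPoly_dvd (hne r hrI) hdv
      have hc0 : c ≠ 0 := by
        rintro rfl
        exact hne k hkI (by rw [hc, zero_smul])
      obtain ⟨t, e1⟩ : ∃ t : K, φ k = t • φ i + c • φ r := by
        refine ⟨φ k v - c * φ r v, ?_⟩
        have := sub_eq_iff_eq_add.mp hc
        generalize φ k v = p at this ⊢
        generalize φ r v = q at this ⊢
        rw [this]; module
      have e2 : φ r = (-(c⁻¹ * t)) • φ i + c⁻¹ • φ k := by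
        rw [e1, smul_add, smul_smul, smul_smul, inv_mul_cancel₀ hc0]
        module
      rcases lt_or_gt_of_ne hrk with hlt | hlt
      · exact hkN (Finset.mem_filter.mpr ⟨hkI, r, hrI, hlt,
          Submodule.mem_span_pair.mpr ⟨_, _, e2.symm⟩⟩)
      · exact hrN (Finset.mem_filter.mpr ⟨hrI, k, hkI, hlt,
          Submodule.mem_span_pair.mpr ⟨_, _, e1.symm⟩⟩)
    · refine hdiv' _ _ (DI_prod (φ := φ) (I := I) (T := I) (w := v)
        (fun j h1 h2 => absurd h1 h2)) ?_
      rw [applyLin_smul, applyLin_constD, D.hv, C_1, mul_one, ← map_prod, ← map_mul, Bpol, mul_comm,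
        Finset.prod_sdiff hNsub]
    · obtain ⟨hrI, hrN⟩ := Finset.mem_sdiff.mp hr
      obtain ⟨w, hw, hw1⟩ := exists_vec φ {r} (φ i) (by
        simp only [Finset.coe_singleton, Set.image_singleton]
        intro hmem
        obtain ⟨c, hc⟩ := Submodule.mem_span_singleton.mp hmem
        exact hPW.2 r (hiI hrI) i hii (fun h => hi (h ▸ hrI)) c hc.symm)
      refine hdiv' _ _ (DI_prod (φ := φ) (I := I) (T := I.erase r) (w := w)
        (fun j h1 h2 => hw j ?_)) ?_
      · by_contra hjr
        exact h2 (Finset.mem_erase.mpr ⟨fun h => hjr (by simp [h]), h1⟩)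
      · rw [applyLin_smul, applyLin_constD, hw1, C_1, mul_one, ← map_prod, ← map_mul, Bpol, mul_comm,
          ← Finset.prod_sdiff (s₁ := Nset φ I i) (s₂ := I.erase r)]
        · congr 3
          ext z; simp only [Finset.mem_erase, Finset.mem_sdiff]; tauto
        · intro z hz
          exact Finset.mem_erase.mpr ⟨fun h => hrN (h ▸ hz), hNsub hz⟩
  refine D.surj' (k := l0) fun h0 => hn ?_
  obtain ⟨x, hx⟩ := hfin
  rw [← constantCoeff_sbst π, hx, map_mul, h0, zero_mul]

/-! ### The Euler derivation -/

theorem degzero {φ : ℕ → Module.Dual K (Fin ℓ → K)} {I : Finset ℕ} {ζ : Deriv K ℓ}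
    (h0 : HomogDeriv ζ 0) (hζ : DI φ I ζ) {α : Module.Dual K (Fin ℓ → K)}
    (hα : α ∈ Submodule.span K (φ '' ↑I)) : applyLin ζ α = 0 := by
  induction hα using Submodule.span_induction with
  | mem x hx =>
    obtain ⟨j, hj, rfl⟩ := hx
    obtain ⟨q, hq⟩ := hζ j hj
    rw [eq_C_of_homog_zero (applyLin_homog h0 (φ j)), hq, map_mul, constantCoeff_linPoly, zero_mul,
      C_0]
  | zero => simp [applyLin]
  | add x y _ _ hx hy => rw [applyLin_addφ, hx, hy, add_zero]
  | smul c x _ hx => rw [applyLin_smulφ, hx, mul_zero]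

theorem euler_coeff {φ : ℕ → Module.Dual K (Fin ℓ → K)} {I : Finset ℕ} {e : Fin ℓ → ℕ}
    {θ : Fin ℓ → Deriv K ℓ} (hb : IsBas φ I e θ) {j : ℕ} (hj : j ∈ I) (hj0 : φ j ≠ 0)
    {c : Fin ℓ → MvPolynomial (Fin ℓ) K} (hc : (eulerD : Deriv K ℓ) = ∑ l, c l • θ l) :
    ∃ l, e l = 1 ∧ constantCoeff (c l) ≠ 0 := by
  obtain ⟨k, hk⟩ : ∃ k, φ j (Pi.single k 1) ≠ 0 := by
    by_contra! h
    exact hj0 (LinearMap.pi_ext' fun k => LinearMap.ext_ring (by simpa using h k))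
  have h1 : linPoly (φ j) = ∑ l, c l * applyLin (θ l) (φ j) := by
    rw [← applyLin_sum, ← hc, applyLin_eulerD]
  rw [← pderiv_linPoly, h1, map_sum, map_sum] at hk
  obtain ⟨l, -, hl⟩ := Finset.exists_ne_zero_of_sum_ne_zero hk
  have hg := applyLin_homog (hb.1 l) (φ j)
  have he : e l ≠ 0 := by
    intro he
    have h2 := hb.1 l
    rw [he] at h2
    rw [degzero h2 (hb.2.1 l) (Submodule.subset_span ⟨j, hj, rfl⟩)] at hl
    simp at hl
  rw [Derivation.leibniz, map_add, smul_eq_mul, smul_eq_mul, map_mul, map_mul,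
    constantCoeff_homog hg he, zero_mul, add_zero] at hl
  refine ⟨l, ?_, left_ne_zero_of_mul hl⟩
  by_contra he1
  exact right_ne_zero_of_mul hl (constantCoeff_homog (hg.pderiv (i := k)) (by omega))

theorem Dat.euler {φ : ℕ → Module.Dual K (Fin ℓ → K)} {I : Finset ℕ} {i : ℕ} {e : Fin ℓ → ℕ}
    {θ : Fin ℓ → Deriv K ℓ} {v : Fin ℓ → K} {π : (Fin ℓ → K) →ₗ[K] (Fin ℓ → K)}
    {f : Fin ℓ → MvPolynomial (Fin ℓ) K} (D : Dat φ I i e θ v π f) (hPW : PW φ (insert i I))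
    (hs : φ i ∈ Submodule.span K (φ '' ↑I)) :
    ∃ c : Fin ℓ → MvPolynomial (Fin ℓ) K, (∑ l, sbst π (c l) * f l = 0) ∧
      ∃ i0, e i0 = 1 ∧ constantCoeff (c i0) ≠ 0 := by
  have hI : I.Nonempty := by
    rw [Finset.nonempty_iff_ne_empty]
    rintro rfl
    simp only [Finset.coe_empty, Set.image_empty, Submodule.span_empty, Submodule.mem_bot] at hs
    exact hPW.1 i (Finset.mem_insert_self _ _) hs
  obtain ⟨j, hj⟩ := hI
  obtain ⟨c, hc⟩ := D.bas.2.2.1 eulerD fun j _ => by rw [applyLin_eulerD]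
  refine ⟨c, ?_, euler_coeff D.bas hj (hPW.1 j (Finset.mem_insert_of_mem hj)) hc⟩
  symm
  apply D.expand
  rw [← hc, applyLin_eulerD, mul_zero]
  exact (D.hz _).mpr (dvd_refl _)

theorem Dat.f_zero {φ : ℕ → Module.Dual K (Fin ℓ → K)} {I : Finset ℕ} {i : ℕ} {e : Fin ℓ → ℕ}
    {θ : Fin ℓ → Deriv K ℓ} {v : Fin ℓ → K} {π : (Fin ℓ → K) →ₗ[K] (Fin ℓ → K)}
    {f : Fin ℓ → MvPolynomial (Fin ℓ) K} (D : Dat φ I i e θ v π f)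
    (hs : φ i ∈ Submodule.span K (φ '' ↑I)) {l : Fin ℓ} (hl : e l = 0) : f l = 0 := by
  have h2 := D.bas.1 l
  rw [hl] at h2
  have h3 := D.hf l
  rw [degzero h2 (D.bas.2.1 l) hs, map_zero] at h3
  exact (mul_eq_zero.mp h3.symm).resolve_left D.B0

theorem Dat.cond {φ : ℕ → Module.Dual K (Fin ℓ → K)} {I : Finset ℕ} {i : ℕ} {e : Fin ℓ → ℕ}
    {θ : Fin ℓ → Deriv K ℓ} {v : Fin ℓ → K} {π : (Fin ℓ → K) →ₗ[K] (Fin ℓ → K)}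
    {f : Fin ℓ → MvPolynomial (Fin ℓ) K} (D : Dat φ I i e θ v π f) (hPW : PW φ (insert i I))
    (hs : φ i ∈ Submodule.span K (φ '' ↑I)) (h : Surj φ I i) :
    ∃ k, constantCoeff (f k) ≠ 0 ∧ e k = (Nset φ I i).card ∧ (Nset φ I i).card ≠ 0 ∧
      ((Nset φ I i).card = 1 → ∃ k', k' ≠ k ∧ e k' = 1) := by
  obtain ⟨k, hk⟩ := D.surj h
  obtain ⟨hek, -⟩ := D.unit_deg hk
  refine ⟨k, hk, hek, fun h0 => ?_, fun h1 => ?_⟩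
  · rw [D.f_zero hs (hek.trans h0), map_zero] at hk
    exact hk rfl
  · obtain ⟨c, hc, i0, hi0, hci0⟩ := D.euler hPW hs
    by_contra! hno
    have hik : i0 = k := by
      by_contra hne
      exact hno i0 hne hi0
    subst hik
    have h2 := congrArg constantCoeff hc
    rw [map_sum, Finset.sum_eq_single i0, map_mul, constantCoeff_sbst, map_zero] at h2
    · exact mul_ne_zero hci0 hk h2
    · intro l _ hl
      rw [map_mul]
      by_cases hfl : constantCoeff (f l) = 0
      · rw [hfl, mul_zero]
      · exact absurd ((D.unit_deg hfl).1.trans h1) (hno l hl)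
    · intro h; exact absurd (Finset.mem_univ _) h

/-! ### Heights -/

theorem height_ker (n : ℕ) : ∀ π : (Fin ℓ → K) →ₗ[K] (Fin ℓ → K), π.comp π = π →
    n ≤ Module.finrank K (LinearMap.ker π) → (n : ℕ∞) ≤ (RingHom.ker (sbst π)).height := by
  induction n with
  | zero => intro π _ _; simp
  | succ n ih =>
    intro π hπ hn
    have hππ : ∀ x, π (π x) = π x := fun x => LinearMap.congr_fun hπ x
    have hne : LinearMap.ker π ≠ ⊥ := by
      intro h
      rw [h, finrank_bot] at hn
      omega
    obtain ⟨v, hv, hv0⟩ := Submodule.exists_mem_ne_zero_of_ne_bot hne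
    rw [LinearMap.mem_ker] at hv
    obtain ⟨ψ, hψ⟩ : ∃ ψ : Module.Dual K (Fin ℓ → K), ψ v = 1 := by
      obtain ⟨k, hk⟩ : ∃ k, v k ≠ 0 := by
        by_contra! h
        exact hv0 (funext h)
      exact ⟨(v k)⁻¹ • LinearMap.proj k, by simp [hk]⟩
    let ψ' : Module.Dual K (Fin ℓ → K) := ψ - ψ.comp π
    have hψv : ψ' v = 1 := by simp [ψ', hv, hψ]
    have hψπ : ∀ x, ψ' (π x) = 0 := fun x => by simp [ψ', hππ]
    let π' : (Fin ℓ → K) →ₗ[K] (Fin ℓ → K) := π + ψ'.smulRight v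
    have hπ' : ∀ x, π' x = π x + ψ' x • v := fun x => by simp [π']
    have hid : π'.comp π' = π' := by
      refine LinearMap.ext fun x => ?_
      simp [hπ', hππ, hv, hψπ, hψv]
    have hfr : n ≤ Module.finrank K (LinearMap.ker π') := by
      have hle : LinearMap.ker π ≤ LinearMap.ker π' ⊔ Submodule.span K {v} := by
        intro x hx
        rw [LinearMap.mem_ker] at hx
        have : x = (x - ψ' x • v) + ψ' x • v := by simp
        rw [this]
        refine Submodule.add_mem_sup ?_ (Submodule.smul_mem _ _ (Submodule.mem_span_singleton_self v))
        simp [hπ', hx, hv, hψv]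
      have h1 := Submodule.finrank_mono hle
      have h2 := Submodule.finrank_add_le_finrank_add_finrank (LinearMap.ker π') (Submodule.span K {v})
      have h3 := finrank_span_le_card (R := K) ({v} : Set (Fin ℓ → K))
      simp only [Set.toFinset_singleton, Finset.card_singleton] at h3
      omega
    have h1 := ih π' hid hfr
    have : (RingHom.ker (sbst π)).IsPrime := RingHom.ker_isPrime _
    have : (RingHom.ker (sbst π')).IsPrime := RingHom.ker_isPrime _
    have hlt : RingHom.ker (sbst π') < RingHom.ker (sbst π) := by
      refine lt_of_le_of_ne (fun x hx => ?_) fun heq => ?_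
      · rw [RingHom.mem_ker] at hx ⊢
        have h2 : π'.comp π = π := LinearMap.ext fun x => by simp [hπ', hππ, hψπ]
        rw [← h2, ← sbst_comp, hx, map_zero]
      · have h2 : linPoly ψ' ∈ RingHom.ker (sbst π) := by
          rw [RingHom.mem_ker, sbst_linPoly]
          have : ψ'.comp π = 0 := LinearMap.ext fun x => by simp [hψπ]
          rw [this]; simp [linPoly]
        rw [← heq, RingHom.mem_ker, sbst_linPoly] at h2
        have h3 : ψ'.comp π' = ψ' := LinearMap.ext fun x => by simp [hπ', hψπ, hψv]
        rw [h3] at h2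
        rw [linPoly_eq_zero h2] at hψv
        simp at hψv
    calc ((n + 1 : ℕ) : ℕ∞) = n + 1 := by push_cast; rfl
      _ ≤ (RingHom.ker (sbst π')).height + 1 := by gcongr
      _ ≤ _ := Ideal.height_add_one_le_of_lt_of_isPrime hlt

theorem linPoly_mem {φ : ℕ → Module.Dual K (Fin ℓ → K)} {J : Finset ℕ}
    {p : Ideal (MvPolynomial (Fin ℓ) K)} (h : ∀ j ∈ J, linPoly (φ j) ∈ p)
    {α : Module.Dual K (Fin ℓ → K)} (hα : α ∈ Submodule.span K (φ '' ↑J)) : linPoly α ∈ p := by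
  induction hα using Submodule.span_induction with
  | mem x hx =>
    obtain ⟨j, hj, rfl⟩ := hx
    exact h j hj
  | zero => simp [linPoly]
  | add x y _ _ hx hy => rw [linPoly_add]; exact p.add_mem hx hy
  | smul c x _ hx => rw [linPoly_smul]; exact p.mul_mem_left _ hx

theorem height_ge (φ : ℕ → Module.Dual K (Fin ℓ → K)) (I : Finset ℕ)
    (p : Ideal (MvPolynomial (Fin ℓ) K)) (hp : ∀ j ∈ I, linPoly (φ j) ∈ p) :
    ((ℓ - Module.finrank K (⨅ j : I, LinearMap.ker (φ j) : Submodule K (Fin ℓ → K)) : ℕ) : ℕ∞) ≤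
      p.height := by
  let W : Submodule K (Fin ℓ → K) := ⨅ j : I, LinearMap.ker (φ j)
  obtain ⟨g, hg⟩ := LinearMap.exists_leftInverse_of_injective W.subtype (by simp)
  have hgw : ∀ w : W, g w = w := fun w => LinearMap.congr_fun hg w
  let π := W.subtype.comp g
  have hπ : π.comp π = π := LinearMap.ext fun x => by
    simp only [π, LinearMap.comp_apply, Submodule.subtype_apply, hgw]
  have h1 : ℓ - Module.finrank K W ≤ Module.finrank K (LinearMap.ker π) := by
    have h2 := LinearMap.finrank_range_add_finrank_ker π
    have h3 : Module.finrank K (LinearMap.range π) ≤ Module.finrank K W := by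
      apply Submodule.finrank_mono
      rintro _ ⟨x, rfl⟩
      exact (g x).2
    rw [Module.finrank_fin_fun] at h2
    omega
  refine (height_ker _ π hπ h1).trans (Ideal.height_mono fun x hx => ?_)
  rw [RingHom.mem_ker] at hx
  have h4 := sub_sbst_mem π p (fun ψ => ?_) x
  · rwa [hx, sub_zero] at h4
  · apply linPoly_mem hp
    have : (⨅ j : I, LinearMap.ker (φ j)) ≤ LinearMap.ker (ψ - ψ.comp π) := by
      intro w hw
      have := hgw ⟨w, hw⟩
      simp only at this
      simp [π, this]
    have := mem_span_of_iInf_ker_le_ker (L := fun j : I => φ j) this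
    convert this
    ext x; simp

/-! ### Degree zero part -/

theorem card_degzero {φ : ℕ → Module.Dual K (Fin ℓ → K)} {I : Finset ℕ} {e : Fin ℓ → ℕ}
    {θ : Fin ℓ → Deriv K ℓ} (hb : IsBas φ I e θ) :
    Module.finrank K (⨅ j : I, LinearMap.ker (φ j) : Submodule K (Fin ℓ → K)) ≤
      (Finset.univ.filter fun l => e l = 0).card := by
  let y : Fin ℓ → (Fin ℓ → K) := fun l k => constantCoeff (θ l k)
  have hle : (⨅ j : I, LinearMap.ker (φ j) : Submodule K (Fin ℓ → K)) ≤
      Submodule.span K (↑((Finset.univ.filter fun l => e l = 0).image y) : Set (Fin ℓ → K)) := by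
    intro w hw
    simp only [Submodule.mem_iInf, LinearMap.mem_ker, Subtype.forall] at hw
    obtain ⟨c, hc⟩ := hb.2.2.1 (constD w) fun j hj => by
      rw [applyLin_constD, hw j hj]; simp
    have : w = ∑ l, constantCoeff (c l) • y l := by
      ext k
      have h1 := congrArg (fun t => constantCoeff (t k)) hc
      simpa [constD, y] using h1
    rw [this]
    refine Submodule.sum_mem _ fun l _ => Submodule.smul_mem _ _ ?_
    by_cases hl : e l = 0
    · apply Submodule.subset_span
      rw [Finset.mem_coe]
      exact Finset.mem_image_of_mem _ (by simp [hl])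
    · have : y l = 0 := by
        ext k
        exact constantCoeff_homog (hb.1 l k) hl
      rw [this]
      exact Submodule.zero_mem _
  exact (Submodule.finrank_mono hle).trans ((finrank_span_finset_le_card _).trans
    Finset.card_image_le)

theorem Nset_filter {φ : ℕ → Module.Dual K (Fin ℓ → K)} {I F : Finset ℕ} {i : ℕ}
    (hF : F ⊆ I)
    (hflat : ∀ j ∈ I, φ j ∈ Submodule.span K (φ '' ↑(insert i F)) → j ∈ F) :
    Nset φ F i = (Nset φ I i).filter (· ∈ F) := by
  ext j
  simp only [Nset, Finset.mem_filter]
  constructor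
  · rintro ⟨hj, k, hk, h1, h2⟩
    exact ⟨⟨hF hj, k, hF hk, h1, h2⟩, hj⟩
  · rintro ⟨⟨-, k, hk, h1, h2⟩, hj⟩
    refine ⟨hj, k, hflat k hk (Submodule.span_mono ?_ h2), h1, h2⟩
    rintro x (rfl | rfl)
    · exact ⟨i, by simp, rfl⟩
    · exact ⟨j, by simp [hj], rfl⟩

theorem Dat.localGlobal {φ : ℕ → Module.Dual K (Fin ℓ → K)} {I : Finset ℕ} {i : ℕ} {e : Fin ℓ → ℕ}
    {θ : Fin ℓ → Deriv K ℓ} {v : Fin ℓ → K} {π : (Fin ℓ → K) →ₗ[K] (Fin ℓ → K)}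
    {f : Fin ℓ → MvPolynomial (Fin ℓ) K} (D : Dat φ I i e θ v π f) (hPW : PW φ (insert i I))
    (hs : φ i ∈ Submodule.span K (φ '' ↑I)) {k1 : Fin ℓ} (hk1 : e k1 = (Nset φ I i).card)
    (hd0 : (Nset φ I i).card ≠ 0) (hd1 : (Nset φ I i).card = 1 → ∃ k', k' ≠ k1 ∧ e k' = 1)
    (hloc : ∀ F ⊆ I, (∀ j ∈ I, φ j ∈ Submodule.span K (φ '' ↑(insert i F)) → j ∈ F) → F ≠ I →
      Surj φ F i) : ∃ k, constantCoeff (f k) ≠ 0 := by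
  by_contra! hcc
  obtain ⟨c, hc, i0, hi0, hci0⟩ := D.euler hPW hs
  obtain ⟨i1, hi1, hei1⟩ : ∃ i1, i1 ≠ i0 ∧ e i1 = (Nset φ I i).card := by
    by_cases h : k1 = i0
    · have hd : (Nset φ I i).card = 1 := by rw [← hk1, h, hi0]
      obtain ⟨k', h1, h2⟩ := hd1 hd
      exact ⟨k', h ▸ h1, h2.trans hd.symm⟩
    · exact ⟨k1, h, hk1⟩
  have hf1 : f i1 = 0 := by
    by_contra hne
    obtain ⟨-, h2⟩ := D.fhom i1 hne
    rw [hei1, Nat.sub_self] at h2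
    rw [eq_C_of_homog_zero h2, hcc, C_0] at hne
    exact hne rfl
  let Z : Finset (Fin ℓ) := Finset.univ.filter fun l => e l = 0
  let Y : Finset (Fin ℓ) := insert i0 (insert i1 Z)
  have hY : Y.card = Z.card + 2 := by
    rw [Finset.card_insert_of_notMem, Finset.card_insert_of_notMem]
    · simp only [Z, Finset.mem_filter]; rw [hei1]; simp [hd0]
    · simp only [Z, Finset.mem_insert, Finset.mem_filter, hi0]
      simp [Ne.symm hi1]
  let G : Finset (MvPolynomial (Fin ℓ) K) := insert (linPoly (φ i)) ((Finset.univ \ Y).image f)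
  have hYl : Y.card ≤ ℓ := by simpa using Finset.card_le_univ Y
  have hG : G.card ≤ ℓ - Z.card - 1 := by
    have h1 : G.card ≤ ((Finset.univ \ Y).image f).card + 1 := Finset.card_insert_le _ _
    have h2 : ((Finset.univ \ Y).image f).card ≤ (Finset.univ \ Y).card := Finset.card_image_le
    have h3 : (Finset.univ \ Y).card = ℓ - Y.card := by
      rw [Finset.card_sdiff_of_subset (Finset.subset_univ _), Finset.card_univ, Fintype.card_fin]
    omega
  have hm : (RingHom.ker (constantCoeff : MvPolynomial (Fin ℓ) K →+* K)).IsPrime :=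
    RingHom.ker_isPrime _
  have hGm : Ideal.span (↑G : Set (MvPolynomial (Fin ℓ) K)) ≤
      RingHom.ker (constantCoeff : MvPolynomial (Fin ℓ) K →+* K) := by
    rw [Ideal.span_le]
    intro x hx
    rcases Finset.mem_insert.mp (Finset.mem_coe.mp hx) with rfl | hx
    · exact constantCoeff_linPoly _
    · obtain ⟨l, -, rfl⟩ := Finset.mem_image.mp hx
      exact hcc l
  obtain ⟨p, hp, hpm⟩ := Ideal.exists_minimalPrimes_le hGm
  have hpp : p.IsPrime := hp.1.1
  have hGp : ∀ x ∈ G, x ∈ p := fun x hx => hp.1.2 (Ideal.subset_span hx)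
  have hht : p.height ≤ (G.card : ℕ∞) := Ideal.height_le_card_of_mem_minimalPrimes_span_finset hp
  have hunit : ∀ x, constantCoeff x ≠ 0 → x ∉ p := fun x hx hxp => hx (hpm hxp)
  have hap : linPoly (φ i) ∈ p := hGp _ (Finset.mem_insert_self _ _)
  have hfp' : ∀ l, l ≠ i0 → f l ∈ p := by
    intro l hl
    by_cases hlY : l ∈ Y
    · simp only [Y, Finset.mem_insert] at hlY
      rcases hlY with h | rfl | h
      · exact absurd h hl
      · rw [hf1]; exact p.zero_mem
      · rw [D.f_zero hs (Finset.mem_filter.mp h).2]; exact p.zero_mem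
    · exact hGp _ (Finset.mem_insert_of_mem (Finset.mem_image_of_mem _ (by simp [hlY])))
  have hfp : ∀ l, f l ∈ p := by
    intro l
    by_cases hl : l = i0
    · subst hl
      have h1 : sbst π (c l) * f l ∈ p := by
        rw [← Finset.add_sum_erase _ _ (Finset.mem_univ l)] at hc
        rw [eq_neg_of_add_eq_zero_left hc]
        refine p.neg_mem (p.sum_mem fun m hm => p.mul_mem_left _ (hfp' m (Finset.ne_of_mem_erase hm)))
      refine (hpp.mem_or_mem h1).resolve_left (hunit _ ?_)
      rwa [constantCoeff_sbst]
    · exact hfp' l hl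
  let F := I.filter fun j => linPoly (φ j) ∈ p
  have hFI : F ⊆ I := Finset.filter_subset _ _
  have hflat : ∀ j ∈ I, φ j ∈ Submodule.span K (φ '' ↑(insert i F)) → j ∈ F := by
    intro j hj hjs
    refine Finset.mem_filter.mpr ⟨hj, linPoly_mem (J := insert i F) (fun k hk => ?_) hjs⟩
    rcases Finset.mem_insert.mp hk with rfl | hk
    · exact hap
    · exact (Finset.mem_filter.mp hk).2
  by_cases hF : F = I
  · have h1 := height_ge φ I p fun j hj => by
      rw [← hF] at hj
      exact (Finset.mem_filter.mp hj).2
    have h2 := card_degzero D.bas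
    have h3 := h1.trans hht
    rw [Nat.cast_le] at h3
    have h4 : (Finset.univ.filter fun l => e l = 0).card = Z.card := rfl
    omega
  · obtain ⟨ζ, hζ, u, hu, hdv⟩ := hloc F hFI hflat hF
    let Q := ∏ k ∈ I \ F, linPoly (φ k)
    have hQ : DI φ I (Q • ζ) := by
      intro j hj
      rw [applyLin_smul]
      by_cases hjF : j ∈ F
      · exact (hζ j hjF).mul_left _
      · exact (Finset.dvd_prod_of_mem _ (Finset.mem_sdiff.mpr ⟨hj, hjF⟩)).mul_right _
    obtain ⟨b, hb⟩ := D.bas.2.2.1 _ hQ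
    have hNI : Nset φ I i ⊆ I := Finset.filter_subset _ _
    have hprod : Q * Bpol φ F i =
        Bpol φ I i * ∏ k ∈ (I \ F) \ Nset φ I i, linPoly (φ k) := by
      simp only [Q, Bpol]
      rw [Nset_filter hFI hflat, ← Finset.prod_inter_mul_prod_sdiff (I \ F) (Nset φ I i),
        ← Finset.prod_filter_mul_prod_filter_not (Nset φ I i) (· ∈ F)]
      have : (I \ F) ∩ Nset φ I i = (Nset φ I i).filter (¬ · ∈ F) := by
        ext x
        simp only [Finset.mem_inter, Finset.mem_sdiff, Finset.mem_filter]
        constructor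
        · tauto
        · rintro ⟨h1, h2⟩; exact ⟨⟨hNI h1, h2⟩, h1⟩
      rw [this]; ring
    rw [← D.hz, map_sub, sub_eq_zero] at hdv
    have h1 : sbst π (applyLin (∑ l, b l • θ l) (φ i)) = sbst π (Bpol φ I i) *
        (sbst π (∏ k ∈ (I \ F) \ Nset φ I i, linPoly (φ k)) * sbst π u) := by
      rw [← hb, applyLin_smul, map_mul, hdv, ← mul_assoc, ← map_mul, ← map_mul, ← map_mul,
        ← mul_assoc, hprod]
    have h2 : sbst π (∏ k ∈ (I \ F) \ Nset φ I i, linPoly (φ k)) * sbst π u ∈ p := by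
      rw [D.expand h1]
      exact p.sum_mem fun l _ => p.mul_mem_left _ (hfp l)
    rcases hpp.mem_or_mem h2 with h3 | h3
    · rw [map_prod, hpp.prod_mem_iff] at h3
      obtain ⟨k, hk, hkp⟩ := h3
      have h5 : ∀ t : K, φ k - t • φ i = φ k + (-t) • φ i := fun t => by module
      rw [sbst_linPoly, D.hπ, h5, linPoly_add, linPoly_smul] at hkp
      have h4 : linPoly (φ k) ∈ p := (p.add_mem_iff_left (p.mul_mem_left _ hap)).mp hkp
      have hkIF := Finset.mem_sdiff.mp (Finset.mem_sdiff.mp hk).1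
      exact hkIF.2 (Finset.mem_filter.mpr ⟨hkIF.1, h4⟩)
    · exact hunit _ (by rwa [constantCoeff_sbst]) h3

/-! ### The combinatorial induction -/

theorem surj_of_not_mem {φ : ℕ → Module.Dual K (Fin ℓ → K)} {I : Finset ℕ} {i : ℕ}
    (hPW : PW φ (insert i I)) (hs : φ i ∉ Submodule.span K (φ '' ↑I)) : Surj φ I i := by
  obtain ⟨v, hv, hv1⟩ := exists_vec φ I (φ i) hs
  have hN : Nset φ I i = ∅ := by
    rw [Finset.eq_empty_iff_forall_notMem]
    intro j hj
    obtain ⟨hjI, k, hk, hkj, hks⟩ := Finset.mem_filter.mp hj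
    obtain ⟨x, y, hxy⟩ := Submodule.mem_span_pair.mp hks
    have h1 := congrArg (fun ψ => ψ v) hxy
    simp only [LinearMap.add_apply, LinearMap.smul_apply, hv1, hv j hjI, hv k hk, smul_eq_mul,
      mul_one, mul_zero, add_zero] at h1
    rw [h1, zero_smul, zero_add] at hxy
    exact hPW.2 j (Finset.mem_insert_of_mem hjI) k (Finset.mem_insert_of_mem hk) hkj.ne' y hxy.symm
  refine ⟨constD v, fun j hj => ?_, 1, by simp, ?_⟩
  · rw [applyLin_constD, hv j hj, C_0]; exact dvd_zero _
  · rw [applyLin_constD, hv1, Bpol, hN]; simp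

theorem IsBas.perm {φ : ℕ → Module.Dual K (Fin ℓ → K)} {I : Finset ℕ} {e : Fin ℓ → ℕ}
    {θ : Fin ℓ → Deriv K ℓ} (h : IsBas φ I e θ) (σ : Equiv.Perm (Fin ℓ)) :
    IsBas φ I (e ∘ σ) (θ ∘ σ) := by
  refine ⟨fun l => h.1 _, fun l => h.2.1 _, fun η hη => ?_, fun c hc l => ?_⟩
  · obtain ⟨c, hc⟩ := h.2.2.1 η hη
    refine ⟨c ∘ σ, hc.trans ?_⟩
    exact (Equiv.sum_comp σ fun l => c l • θ l).symm
  · have := h.2.2.2 (c ∘ σ.symm) (by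
      rw [← hc, ← Equiv.sum_comp σ]
      simp) (σ l)
    simpa using this

theorem IsBas_empty (φ : ℕ → Module.Dual K (Fin ℓ → K)) :
    IsBas φ ∅ (fun _ => 0) (fun l => constD (Pi.single l 1)) := by
  have key : ∀ c : Fin ℓ → MvPolynomial (Fin ℓ) K,
      ∑ l, c l • (constD (Pi.single l 1) : Deriv K ℓ) = c := by
    intro c
    ext1 k
    simp only [Finset.sum_apply, Pi.smul_apply, smul_eq_mul, constD]
    rw [Finset.sum_eq_single k]
    · simp
    · intro l _ hl; simp [hl.symm]
    · intro h; exact absurd (Finset.mem_univ _) h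
  refine ⟨fun l k => isHomogeneous_C _ _, fun l j hj => absurd hj (Finset.notMem_empty _),
    fun η _ => ⟨η, (key η).symm⟩, fun c hc l => ?_⟩
  rw [key] at hc
  rw [hc]; rfl

/-- Same ranks. -/
def SR (φ φ' : ℕ → Module.Dual K (Fin ℓ → K)) (I : Finset ℕ) : Prop :=
  ∀ J ⊆ I, Module.finrank K (Submodule.span K (φ '' (↑J : Set ℕ))) =
    Module.finrank K (Submodule.span K (φ' '' (↑J : Set ℕ)))

theorem mem_span_iff_rank (φ : ℕ → Module.Dual K (Fin ℓ → K)) (F : Finset ℕ) (j : ℕ) :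
    φ j ∈ Submodule.span K (φ '' (↑F : Set ℕ)) ↔
      Module.finrank K (Submodule.span K (φ '' (↑(insert j F) : Set ℕ))) =
        Module.finrank K (Submodule.span K (φ '' (↑F : Set ℕ))) := by
  rw [Finset.coe_insert, Set.image_insert_eq]
  constructor
  · intro h
    rw [Submodule.span_insert_eq_span h]
  · intro h
    have h1 : Submodule.span K (φ '' (↑F : Set ℕ)) ≤
        Submodule.span K (insert (φ j) (φ '' (↑F : Set ℕ))) :=
      Submodule.span_mono (Set.subset_insert _ _)
    rw [Submodule.eq_of_le_of_finrank_eq h1 h.symm]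
    exact Submodule.subset_span (Set.mem_insert _ _)

theorem SR.mem_iff {φ φ' : ℕ → Module.Dual K (Fin ℓ → K)} {I : Finset ℕ} (h : SR φ φ' I)
    {F : Finset ℕ} (hF : F ⊆ I) {j : ℕ} (hj : j ∈ I) :
    φ j ∈ Submodule.span K (φ '' (↑F : Set ℕ)) ↔ φ' j ∈ Submodule.span K (φ' '' (↑F : Set ℕ)) := by
  rw [mem_span_iff_rank, mem_span_iff_rank, h F hF, h (insert j F) (Finset.insert_subset hj hF)]

theorem SR.Nset_eq {φ φ' : ℕ → Module.Dual K (Fin ℓ → K)} {I : Finset ℕ} {i : ℕ}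
    (h : SR φ φ' (insert i I)) : Nset φ I i = Nset φ' I i := by
  simp only [Nset]
  refine Finset.filter_congr fun j hj => ?_
  have key : ∀ k ∈ I, (φ k ∈ Submodule.span K {φ i, φ j} ↔ φ' k ∈ Submodule.span K {φ' i, φ' j}) := by
    intro k hk
    have := h.mem_iff (F := {i, j}) (j := k) (by
      intro x hx
      rcases Finset.mem_insert.mp hx with rfl | hx
      · exact Finset.mem_insert_self _ _
      · rw [Finset.mem_singleton.mp hx]; exact Finset.mem_insert_of_mem hj)
      (Finset.mem_insert_of_mem hk)
    simpa [Set.image_insert_eq] using this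
  constructor
  · rintro ⟨k, hk, h1, h2⟩; exact ⟨k, hk, h1, (key k hk).mp h2⟩
  · rintro ⟨k, hk, h1, h2⟩; exact ⟨k, hk, h1, (key k hk).mpr h2⟩

/-- Every step is good. -/
def CS (φ : ℕ → Module.Dual K (Fin ℓ → K)) (I : Finset ℕ) : Prop :=
  ∀ i ∈ I, Surj φ (I.filter (· < i)) i

theorem main_induction (φ φ' : ℕ → Module.Dual K (Fin ℓ → K)) (n : ℕ) :
    ∀ I : Finset ℕ, I.card = n → PW φ I → PW φ' I → SR φ φ' I → CS φ I →
      CS φ' I ∧ ∃ e, (∃ θ, IsBas φ I e θ) ∧ ∃ θ', IsBas φ' I e θ' := by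
  induction n using Nat.strong_induction_on with
  | _ n ih =>
  intro I hn hP hP' hSR hCS
  rcases I.eq_empty_or_nonempty with rfl | hne
  · exact ⟨fun i hi => absurd hi (Finset.notMem_empty _), fun _ => 0, ⟨_, IsBas_empty φ⟩,
      ⟨_, IsBas_empty φ'⟩⟩
  obtain ⟨i, hiI, hmax⟩ : ∃ i ∈ I, ∀ j ∈ I, j ≤ i := ⟨I.max' hne, I.max'_mem hne, I.le_max'⟩
  obtain ⟨I0, hi0, rfl⟩ : ∃ I0, i ∉ I0 ∧ I = insert i I0 :=
    ⟨I.erase i, Finset.notMem_erase _ _, (Finset.insert_erase hiI).symm⟩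
  have hsub : I0 ⊆ insert i I0 := Finset.subset_insert _ _
  have hlt : ∀ j ∈ I0, j < i := fun j hj =>
    lt_of_le_of_ne (hmax j (hsub hj)) fun h => hi0 (h ▸ hj)
  have hfi : ∀ F ⊆ I0, (insert i F).filter (· < i) = F := by
    intro F hF
    ext x
    simp only [Finset.mem_filter, Finset.mem_insert]
    constructor
    · rintro ⟨rfl | h, h'⟩
      · exact absurd h' (lt_irrefl _)
      · exact h
    · intro h; exact ⟨Or.inr h, hlt x (hF h)⟩
  have hfj : ∀ F ⊆ I0, ∀ j ∈ I0, (insert i F).filter (· < j) = F.filter (· < j) := by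
    intro F hF j hj
    ext x
    simp only [Finset.mem_filter, Finset.mem_insert]
    constructor
    · rintro ⟨rfl | h, h'⟩
      · exact absurd (h'.trans (hlt j hj)) (lt_irrefl _)
      · exact ⟨h, h'⟩
    · intro h; exact ⟨Or.inr h.1, h.2⟩
  have hS : Surj φ I0 i := by
    have := hCS i hiI
    rwa [hfi I0 subset_rfl] at this
  have hCS0 : CS φ I0 := by
    intro j hj
    have := hCS j (hsub hj)
    rwa [hfj I0 subset_rfl j hj] at this
  have hcard : I0.card < n := by rw [← hn, Finset.card_insert_of_notMem hi0]; omega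
  obtain ⟨hCS0', e, ⟨θ, hθ⟩, θ', hθ'⟩ := ih _ hcard I0 rfl (hP.mono hsub) (hP'.mono hsub)
    (fun J hJ => hSR J (hJ.trans hsub)) hCS0
  have hN := hSR.Nset_eq
  obtain ⟨v, π, f, D⟩ := exists_Dat hP hi0 hθ
  obtain ⟨v', π', f', D'⟩ := exists_Dat hP' hi0 hθ'
  have key : ∃ k', constantCoeff (f' k') ≠ 0 := by
    by_cases hs : φ i ∈ Submodule.span K (φ '' ↑I0)
    · obtain ⟨k, -, hk, hd0, hd1⟩ := D.cond hP hs hS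
      rw [hN] at hk hd0 hd1
      refine D'.localGlobal hP' ((hSR.mem_iff hsub hiI).mp hs) hk hd0 hd1 fun F hF hflat hne => ?_
      have hFi : insert i F ⊆ insert i I0 := Finset.insert_subset_insert _ hF
      have hflat0 : ∀ j ∈ I0, φ j ∈ Submodule.span K (φ '' ↑(insert i F)) → j ∈ F :=
        fun j hj hjs => hflat j hj ((hSR.mem_iff hFi (hsub hj)).mp hjs)
      have hCSF : CS φ (insert i F) := by
        intro j hj
        rcases Finset.mem_insert.mp hj with rfl | hj
        · rw [hfi F hF]
          exact hS.localize hF hflat0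
        · rw [hfj F hF j (hF hj)]
          refine (hCS0 j (hF hj)).localize (Finset.filter_subset_filter _ hF) fun m hm hms => ?_
          obtain ⟨hmI, hmj⟩ := Finset.mem_filter.mp hm
          refine Finset.mem_filter.mpr ⟨hflat0 m hmI (Submodule.span_mono ?_ hms), hmj⟩
          apply Set.image_mono
          intro x hx
          rcases Finset.mem_insert.mp (Finset.mem_coe.mp hx) with rfl | hx
          · exact Finset.mem_coe.mpr (Finset.mem_insert_of_mem hj)
          · exact Finset.mem_coe.mpr (Finset.mem_insert_of_mem (Finset.mem_filter.mp hx).1)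
      have hcF : (insert i F).card < n := by
        rw [← hn, Finset.card_insert_of_notMem hi0,
          Finset.card_insert_of_notMem fun h => hi0 (hF h)]
        have := Finset.card_lt_card (Finset.ssubset_iff_subset_ne.mpr ⟨hF, hne⟩)
        omega
      have hres := (ih _ hcF (insert i F) rfl (hP.mono hFi) (hP'.mono hFi)
        (fun J hJ => hSR J (hJ.trans hFi)) hCSF).1 i (Finset.mem_insert_self _ _)
      rwa [hfi F hF] at hres
    · exact D'.surj (surj_of_not_mem hP' fun h => hs ((hSR.mem_iff hsub hiI).mpr h))
  obtain ⟨k', hk'⟩ := key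
  obtain ⟨k, hk⟩ := D.surj hS
  refine ⟨fun j hj => ?_, Function.update e k (e k + 1), D.exchange hk, ?_⟩
  · rcases Finset.mem_insert.mp hj with rfl | hj
    · rw [hfi I0 subset_rfl]; exact D'.surj' hk'
    · rw [hfj I0 subset_rfl j hj]; exact hCS0' j hj
  · obtain ⟨ζ, hζ⟩ := D'.exchange hk'
    refine ⟨ζ ∘ Equiv.swap k k', ?_⟩
    · have h1 := hζ.perm (Equiv.swap k k')
      have hee : e k = e k' := by rw [(D.unit_deg hk).1, (D'.unit_deg hk').1, hN]
      have h2 : Function.update e k' (e k' + 1) ∘ Equiv.swap k k' = Function.update e k (e k + 1) := by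
        ext l
        simp only [Function.comp_apply]
        by_cases hl : l = k
        · subst hl; simp [hee]
        · by_cases hl' : l = k'
          · subst hl'
            rw [Equiv.swap_apply_right, Function.update_of_ne hl,
              Function.update_of_ne (Ne.symm hl), hee]
          · rw [Equiv.swap_apply_of_ne_of_ne hl hl', Function.update_of_ne hl,
              Function.update_of_ne hl']
      rw [h2] at h1
      exact h1

/-! ### From arrangements to indexed families -/

theorem eq_smul_of_ker {α ψ : Module.Dual K (Fin ℓ → K)} (hα : α ≠ 0)
    (h : LinearMap.ker ψ = LinearMap.ker α) : ∃ c : K, ψ = c • α := by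
  obtain ⟨w, hw⟩ : ∃ w, α w ≠ 0 := by
    by_contra! h
    exact hα (LinearMap.ext h)
  refine ⟨ψ w * (α w)⁻¹, LinearMap.ext fun x => ?_⟩
  have hx : x - (α x * (α w)⁻¹) • w ∈ LinearMap.ker α := by
    simp [hw]
  rw [← h, LinearMap.mem_ker, map_sub, map_smul, sub_eq_zero] at hx
  rw [hx]
  simp only [smul_eq_mul, LinearMap.smul_apply]; ring

theorem InD_iff {φ : ℕ → Module.Dual K (Fin ℓ → K)} {h : ℕ → Submodule K (Fin ℓ → K)}
    {J : Finset ℕ} (h0 : ∀ j ∈ J, φ j ≠ 0) (hk : ∀ j ∈ J, LinearMap.ker (φ j) = h j)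
    (θ : Deriv K ℓ) : InD (J.image h) θ ↔ DI φ J θ := by
  constructor
  · intro H j hj
    exact H (h j) (Finset.mem_image_of_mem h hj) (φ j) (hk j hj)
  · intro H X hX ψ hψ
    obtain ⟨j, hj, rfl⟩ := Finset.mem_image.mp hX
    obtain ⟨c, rfl⟩ := eq_smul_of_ker (h0 j hj) (hψ.trans (hk j hj).symm)
    rw [linPoly_smul, applyLin_smulφ]
    exact mul_dvd_mul_left _ (H j hj)

theorem IsFree_iff {φ : ℕ → Module.Dual K (Fin ℓ → K)} {h : ℕ → Submodule K (Fin ℓ → K)}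
    {J : Finset ℕ} (h0 : ∀ j ∈ J, φ j ≠ 0) (hk : ∀ j ∈ J, LinearMap.ker (φ j) = h j) :
    IsFree (J.image h) ↔ ∃ e θ, IsBas φ J e θ := by
  have key := InD_iff h0 hk
  simp only [IsFree, IsFreeExp, GeneratesD, IsBas, key, and_assoc]

theorem rank_eq {φ : ℕ → Module.Dual K (Fin ℓ → K)} {h : ℕ → Submodule K (Fin ℓ → K)}
    {J : Finset ℕ} (hk : ∀ j ∈ J, LinearMap.ker (φ j) = h j) :
    Module.finrank K (Submodule.span K (φ '' (↑J : Set ℕ))) +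
      Module.finrank K ((J.image h).inf id : Submodule K (Fin ℓ → K)) = ℓ := by
  have h1 : ((J.image h).inf id : Submodule K (Fin ℓ → K)) =
      (Submodule.span K (φ '' (↑J : Set ℕ))).dualCoannihilator := by
    ext x
    rw [Submodule.mem_dualCoannihilator]
    simp only [Finset.inf_image, Function.id_comp, Submodule.mem_finsetInf]
    constructor
    · intro H ψ hψ
      induction hψ using Submodule.span_induction with
      | mem y hy =>
        obtain ⟨j, hj, rfl⟩ := hy
        have := H j hj
        rwa [← hk j hj] at this
      | zero => simp
      | add y z _ _ hy hz => simp [hy, hz]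
      | smul c y _ hy => simp [hy]
    · intro H j hj
      rw [← hk j hj]
      exact H _ (Submodule.subset_span ⟨j, hj, rfl⟩)
  rw [h1, Subspace.finrank_add_finrank_dualCoannihilator_eq, Module.finrank_fin_fun]

theorem PW_of_ker {φ : ℕ → Module.Dual K (Fin ℓ → K)} {h : ℕ → Submodule K (Fin ℓ → K)}
    {J : Finset ℕ} (h0 : ∀ j ∈ J, φ j ≠ 0) (hk : ∀ j ∈ J, LinearMap.ker (φ j) = h j)
    (hinj : ∀ j ∈ J, ∀ k ∈ J, h j = h k → j = k) : PW φ J := by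
  refine ⟨h0, fun j hj k hk' hjk c hc => hjk (hinj j hj k hk' ?_)⟩
  have hc0 : c ≠ 0 := by
    rintro rfl
    exact h0 k hk' (by rw [hc, zero_smul])
  rw [← hk j hj, ← hk k hk', hc, LinearMap.ker_smul _ _ hc0]

theorem LatticeEquiv.symm' {A B : Finset (Submodule K (Fin ℓ → K))} (h : LatticeEquiv A B) :
    LatticeEquiv B A := by
  obtain ⟨σ, hσ, hr⟩ := h
  have hinv := hσ.invOn_invFunOn
  have hτ : Set.BijOn (Function.invFunOn σ ↑A) ↑B ↑A := hσ.symm hinv.symm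
  refine ⟨Function.invFunOn σ ↑A, hτ, fun T hT => ?_⟩
  have h1 : T.image (Function.invFunOn σ ↑A) ⊆ A := by
    intro x hx
    obtain ⟨y, hy, rfl⟩ := Finset.mem_image.mp hx
    exact hτ.mapsTo (hT hy)
  have h2 : (T.image (Function.invFunOn σ ↑A)).image σ = T := by
    rw [Finset.image_image]
    conv_rhs => rw [← Finset.image_id (s := T)]
    refine Finset.image_congr fun y hy => ?_
    exact hinv.2 (hT hy)
  rw [hr _ h1, h2]

theorem transfer {A B : Finset (Submodule K (Fin ℓ → K))} (hA : IsArrangement A)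
    (hB : IsArrangement B) (h : LatticeEquiv A B) (hF : HasFreeFiltration A) :
    HasFreeFiltration B := by
  obtain ⟨σ, hσ, hr⟩ := h
  obtain ⟨c, hcA, hc, hcs⟩ := hF
  set n := A.card with hn
  have hex : ∀ i, ∃ H, i < n → H ∉ c i ∧ c (i + 1) = insert H (c i) := by
    intro i
    by_cases hi : i < n
    · have h1 := (hc i hi.le).1
      have h2 := (hc (i + 1) hi).1
      have h3 : (c (i + 1) \ c i).card = 1 := by
        rw [Finset.card_sdiff_of_subset (hcs i hi), h1, h2]; omega
      obtain ⟨H, hH⟩ := Finset.card_eq_one.mp h3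
      refine ⟨H, fun _ => ⟨?_, ?_⟩⟩
      · have : H ∈ c (i + 1) \ c i := by rw [hH]; exact Finset.mem_singleton_self _
        exact (Finset.mem_sdiff.mp this).2
      · rw [← Finset.sdiff_union_of_subset (hcs i hi), hH]; rfl
    · exact ⟨⊥, fun h => absurd h hi⟩
  choose h hh using hex
  have hci : ∀ i ≤ n, c i = (Finset.range i).image h := by
    intro i
    induction i with
    | zero =>
      intro hi
      have := (hc 0 hi).1
      rw [Finset.card_eq_zero] at this
      simp [this]
    | succ i ih =>
      intro hi
      rw [(hh i hi).2, ih (by omega), Finset.range_add_one, Finset.image_insert]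
  have hinj : ∀ j ∈ Finset.range n, ∀ k ∈ Finset.range n, h j = h k → j = k := by
    have hlt : ∀ j k, j < k → k < n → h j ≠ h k := by
      intro j k hjk hk heq
      apply (hh k hk).1
      rw [← heq, hci k hk.le]
      exact Finset.mem_image_of_mem _ (Finset.mem_range.mpr hjk)
    intro j hj k hk heq
    by_contra hne
    rcases lt_or_gt_of_ne hne with h1 | h1
    · exact hlt j k h1 (Finset.mem_range.mp hk) heq
    · exact hlt k j h1 (Finset.mem_range.mp hj) heq.symm
  have hAim : A = (Finset.range n).image h := by rw [← hci n le_rfl, hcA]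
  have hmem : ∀ j ∈ Finset.range n, h j ∈ A := fun j hj => by
    rw [hAim]; exact Finset.mem_image_of_mem _ hj
  have hmem' : ∀ j ∈ Finset.range n, σ (h j) ∈ B := fun j hj => hσ.mapsTo (hmem j hj)
  have hφ : ∀ j, ∃ φ : Module.Dual K (Fin ℓ → K), j ∈ Finset.range n → φ ≠ 0 ∧
      LinearMap.ker φ = h j := by
    intro j
    by_cases hj : j ∈ Finset.range n
    · obtain ⟨φ, h1⟩ := hA _ (hmem j hj)
      exact ⟨φ, fun _ => h1⟩
    · exact ⟨0, fun h => absurd h hj⟩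
  choose φ hφ using hφ
  have hφ' : ∀ j, ∃ φ : Module.Dual K (Fin ℓ → K), j ∈ Finset.range n → φ ≠ 0 ∧
      LinearMap.ker φ = (σ ∘ h) j := by
    intro j
    by_cases hj : j ∈ Finset.range n
    · obtain ⟨φ, h1⟩ := hB _ (hmem' j hj)
      exact ⟨φ, fun _ => h1⟩
    · exact ⟨0, fun h => absurd h hj⟩
  choose φ' hφ' using hφ'
  have hinj' : ∀ j ∈ Finset.range n, ∀ k ∈ Finset.range n, (σ ∘ h) j = (σ ∘ h) k → j = k :=
    fun j hj k hk heq => hinj j hj k hk (hσ.injOn (hmem j hj) (hmem k hk) heq)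
  have hsub : ∀ i ≤ n, Finset.range i ⊆ Finset.range n := fun i hi => Finset.range_mono hi
  have hP : PW φ (Finset.range n) :=
    PW_of_ker (fun j hj => (hφ j hj).1) (fun j hj => (hφ j hj).2) hinj
  have hP' : PW φ' (Finset.range n) :=
    PW_of_ker (fun j hj => (hφ' j hj).1) (fun j hj => (hφ' j hj).2) hinj'
  have hSR : SR φ φ' (Finset.range n) := by
    intro J hJ
    have h1 := rank_eq (J := J) (fun j hj => (hφ j (hJ hj)).2)
    have h2 := rank_eq (J := J) (fun j hj => (hφ' j (hJ hj)).2)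
    have h3 := hr (J.image h) (by
      rw [hAim]; exact Finset.image_subset_image hJ)
    rw [Finset.image_image] at h3
    omega
  have hfree : ∀ i ≤ n, ∃ e θ, IsBas φ (Finset.range i) e θ := by
    intro i hi
    have := (hc i hi).2
    rw [hci i hi] at this
    exact (IsFree_iff (fun j hj => (hφ j (hsub i hi hj)).1)
      (fun j hj => (hφ j (hsub i hi hj)).2)).mp this
  have hfil : ∀ i ≤ n, ∀ j ∈ Finset.range i, (Finset.range i).filter (· < j) = Finset.range j := by
    intro i hi j hj
    ext x
    simp only [Finset.mem_filter, Finset.mem_range] at hj ⊢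
    omega
  have hCS : ∀ i ≤ n, CS φ (Finset.range i) := by
    intro i hi j hj
    rw [hfil i hi j hj]
    have hjn : j < n := lt_of_lt_of_le (Finset.mem_range.mp hj) hi
    obtain ⟨e, θ, hb⟩ := hfree j hjn.le
    obtain ⟨e', η, hb'⟩ := hfree (j + 1) hjn
    rw [Finset.range_add_one] at hb'
    refine surj_of_bas (hP.mono ?_) Finset.notMem_range_self hb hb'
    rw [← Finset.range_add_one]
    exact hsub _ hjn
  have hBim : B = (Finset.range n).image (σ ∘ h) := by
    rw [← Finset.image_image, ← hAim]
    apply Finset.coe_injective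
    rw [Finset.coe_image, hσ.image_eq]
  have hcard : ∀ i ≤ n, ((Finset.range i).image (σ ∘ h)).card = i := by
    intro i hi
    rw [Finset.card_image_of_injOn, Finset.card_range]
    intro j hj k hk heq
    exact hinj' j (hsub i hi hj) k (hsub i hi hk) heq
  have hBn : B.card = n := by rw [hBim, hcard n le_rfl]
  refine ⟨fun i => (Finset.range i).image (σ ∘ h), ?_, fun i hi => ?_, fun i hi => ?_⟩
  · simp only [hBn]; exact hBim.symm
  · rw [hBn] at hi
    refine ⟨hcard i hi, ?_⟩
    obtain ⟨-, e, -, θ', hb⟩ := main_induction φ φ' _ (Finset.range i) rfl (hP.mono (hsub i hi))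
      (hP'.mono (hsub i hi)) (fun J hJ => hSR J (hJ.trans (hsub i hi))) (hCS i hi)
    exact (IsFree_iff (fun j hj => (hφ' j (hsub i hi hj)).1)
      (fun j hj => (hφ' j (hsub i hi hj)).2)).mpr ⟨e, θ', hb⟩
  · exact Finset.image_subset_image (Finset.range_mono (Nat.le_succ i))

/-- Theorem `FF`: for `ℓ ≤ 4`, whether an arrangement has a free
filtration depends only on the intersection lattice. -/
theorem free_filtration_combinatorial {K : Type} [Field K] {ℓ : ℕ} (hl : ℓ ≤ 4)
    (A B : Finset (Submodule K (Fin ℓ → K)))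
    (hA : IsArrangement A) (hEssA : Essential A)
    (hB : IsArrangement B) (hEssB : Essential B)
    (h : LatticeEquiv A B) :
    HasFreeFiltration A ↔ HasFreeFiltration B := by
  exact ⟨transfer hA hB h, transfer hB hA (LatticeEquiv.symm' h)⟩

end ArrPOG
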